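/- arXiv:math/0004134 — 6 statements merged into one kernel-verified Lean document; each statement's English description precedes it below -/
import Mathlib

section
/- Let Y be a compact Hausdorff topological space and let (F_n) be a sequence of continuous functions F_n : Y → ℝ converging uniformly to a continuous function F : Y → ℝ. Let Z_n = F_n⁻¹({0}) and Z = F⁻¹({0}). If Z_n is connected (as a subspace of Y) for every n, then for every point x ∈ ⋂_n Z_n the whole intersection ⋂_n Z_n is contained in the connected component of x inside Z; in particular ⋂_n Z_n lies in a single connected component of Z. -/
/-- In a Hausdorff space, two points of a compact set `K` lie in the same connected component of
`K` as soon as every open neighbourhood of `K` contains a preconnected set joining them. -/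
theorem IsCompact.mem_connectedComponentIn_of_forall_isOpen {X : Type*} [TopologicalSpace X]
    [T2Space X] {K : Set X} (hK : IsCompact K) {x y : X} (hx : x ∈ K) (hy : y ∈ K)
    (h : ∀ U, IsOpen U → K ⊆ U → ∃ S ⊆ U, IsPreconnected S ∧ x ∈ S ∧ y ∈ S) :
    y ∈ connectedComponentIn K x := by
  have : CompactSpace K := isCompact_iff_compactSpace.mp hK
  rw [connectedComponentIn_eq_image hx]
  refine ⟨⟨y, hy⟩, ?_, rfl⟩
  rw [connectedComponent_eq_iInter_isClopen, Set.mem_iInter]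
  rintro ⟨A, hA, hxA⟩
  by_contra hyA
  have hdisj : Disjoint (Subtype.val '' A) (Subtype.val '' Aᶜ) :=
    Set.disjoint_image_of_injective Subtype.val_injective disjoint_compl_right
  obtain ⟨U, V, hU, hV, hAU, hAV, hUV⟩ := SeparatedNhds.of_isCompact_isCompact
    (hA.isClosed.isCompact.image continuous_subtype_val)
    (hA.compl.isClosed.isCompact.image continuous_subtype_val) hdisj
  have hKUV : K ⊆ U ∪ V := fun z hz => by
    by_cases hzA : (⟨z, hz⟩ : K) ∈ A
    · exact Or.inl (hAU ⟨_, hzA, rfl⟩)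
    · exact Or.inr (hAV ⟨_, hzA, rfl⟩)
  obtain ⟨S, hSUV, hS, hxS, hyS⟩ := h (U ∪ V) (hU.union hV) hKUV
  have hSU : S ⊆ U :=
    hS.subset_left_of_subset_union hU hV hUV hSUV ⟨x, hxS, hAU ⟨_, hxA, rfl⟩⟩
  exact Set.disjoint_left.mp hUV (hSU hyS) (hAV ⟨_, hyA, rfl⟩)

/-- On a compact space, if `F i` converges uniformly to a continuous `f`, then the zero sets of
`F i` are eventually contained in any given open neighbourhood of the zero set of `f`. -/
theorem TendstoUniformly.eventually_preimage_zero_subset {X ι : Type*} [TopologicalSpace X]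
    [CompactSpace X] {l : Filter ι} {F : ι → X → ℝ} {f : X → ℝ} (hF : TendstoUniformly F f l)
    (hf : Continuous f) {U : Set X} (hU : IsOpen U) (hfU : f ⁻¹' {0} ⊆ U) :
    ∀ᶠ i in l, F i ⁻¹' {0} ⊆ U := by
  obtain ⟨ε, hε, hεf⟩ := hU.isClosed_compl.isCompact.exists_forall_le' (f := fun z => |f z|)
    hf.abs.continuousOn (a := 0) fun z hz => abs_pos.mpr fun h0 => hz (hfU h0)
  filter_upwards [Metric.tendstoUniformly_iff.mp hF ε hε] with i hi z hz
  by_contra hzU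
  have hdist := hi z
  rw [show F i z = 0 from hz, Real.dist_eq, sub_zero] at hdist
  exact (hεf z hzU).not_gt hdist

/-- **Lemma (hsdorff).** Let `Y` be a compact Hausdorff space and `F n : Y → ℝ` a sequence of
continuous functions converging uniformly to a continuous `Flim`. If the zero set of each `F n`
is connected, then the intersection of all these zero sets is contained in a single connected
component of the zero set of `Flim`: namely, for every `x` in the intersection, the whole
intersection lies in the connected component of `x` inside `Flim ⁻¹' {0}`. -/
theorem stmt_0 {Y : Type*} [TopologicalSpace Y] [CompactSpace Y] [T2Space Y]
    (F : ℕ → Y → ℝ) (Flim : Y → ℝ)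
    (hFcont : ∀ n, Continuous (F n)) (hFlimcont : Continuous Flim)
    (hunif : TendstoUniformly F Flim Filter.atTop)
    (hconn : ∀ n, IsConnected ((F n) ⁻¹' ({0} : Set ℝ)))
    (x : Y) (hx : x ∈ ⋂ n, (F n) ⁻¹' ({0} : Set ℝ)) :
    (⋂ n, (F n) ⁻¹' ({0} : Set ℝ)) ⊆
      connectedComponentIn (Flim ⁻¹' ({0} : Set ℝ)) x := by
  have hzero : ∀ z ∈ ⋂ n, (F n) ⁻¹' ({0} : Set ℝ), z ∈ Flim ⁻¹' ({0} : Set ℝ) := fun z hz => by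
    have hFz : ∀ n, F n z = 0 := fun n => Set.mem_iInter.mp hz n
    have hlim := hunif.tendsto_at z
    simp only [hFz] at hlim
    exact tendsto_nhds_unique hlim tendsto_const_nhds
  intro y hy
  have hK : IsCompact (Flim ⁻¹' ({0} : Set ℝ)) := (isClosed_singleton.preimage hFlimcont).isCompact
  refine hK.mem_connectedComponentIn_of_forall_isOpen (hzero x hx) (hzero y hy) fun U hU hZU => ?_
  obtain ⟨n, hn⟩ := (hunif.eventually_preimage_zero_subset hFlimcont hU hZU).exists
  exact ⟨_, hn, (hconn n).isPreconnected, Set.mem_iInter.mp hx n, Set.mem_iInter.mp hy n⟩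
end

section
/- Fix integers q ≥ 1 and n ≥ 1. Suppose the set of n-tuples (p₁,…,pₙ) ∈ (ℝP²)ⁿ for which there exists a nonzero homogeneous polynomial F ∈ ℝ[x₀,x₁,x₂] of degree q whose real point set Z(F) is nonempty, connected, and contains all the points p₁,…,pₙ, is dense in (ℝP²)ⁿ (with the product topology). Then for EVERY n-tuple (p₁,…,pₙ) ∈ (ℝP²)ⁿ there exists a nonzero homogeneous polynomial F ∈ ℝ[x₀,x₁,x₂] of degree q such that some connected component of Z(F) contains all the points p₁,…,pₙ. -/
noncomputable section

/-- The real projective plane, the projectivization of `ℝ³`. -/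
abbrev RP2 := Projectivization ℝ (Fin 3 → ℝ)

/-- `ℝP²` carries the quotient topology from `ℝ³ ∖ {0}`. -/
instance : TopologicalSpace RP2 :=
  inferInstanceAs (TopologicalSpace (Quotient (projectivizationSetoid ℝ (Fin 3 → ℝ))))

/-- The real point set of the plane curve defined by `F ∈ ℝ[x₀,x₁,x₂]`; for homogeneous `F`
this is well defined (independent of the representative). -/
def zeroSet (F : MvPolynomial (Fin 3) ℝ) : Set RP2 :=
  {p | MvPolynomial.eval p.rep F = 0}

/-- The set `S` lies in a single connected component of `Z ⊆ ℝP²` (with the subspace topology):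
some connected component of `Z` contains `S`. -/
def inOneComponent (Z S : Set RP2) : Prop :=
  ∃ p ∈ Z, S ⊆ connectedComponentIn Z p

open Filter Topology Set

/-- Scaling the point scales the value of a homogeneous polynomial by a power of the scalar. -/
lemma MvPolynomial.IsHomogeneous.eval_smul_eq {σ R : Type*} [CommSemiring R]
    {F : MvPolynomial σ R} {q : ℕ} (hF : F.IsHomogeneous q) (a : R) (x : σ → R) :
    MvPolynomial.eval (a • x) F = a ^ q * MvPolynomial.eval x F := by
  rw [MvPolynomial.eval_eq, MvPolynomial.eval_eq, Finset.mul_sum]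
  refine Finset.sum_congr rfl fun d hd => ?_
  have hdeg : ∑ i ∈ d.support, d i = q := by
    by_contra h
    exact MvPolynomial.mem_support_iff.1 hd (hF.coeff_eq_zero h)
  simp only [Pi.smul_apply, smul_eq_mul, mul_pow, Finset.prod_mul_distrib,
    Finset.prod_pow_eq_pow_sum, hdeg]
  ring

namespace RP2

lemma mk_mem_zeroSet_iff {F : MvPolynomial (Fin 3) ℝ} {q : ℕ} (hF : F.IsHomogeneous q)
    (x : Fin 3 → ℝ) (hx : x ≠ 0) :
    Projectivization.mk ℝ x hx ∈ zeroSet F ↔ MvPolynomial.eval x F = 0 := by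
  obtain ⟨a, ha⟩ := Projectivization.exists_smul_eq_mk_rep ℝ x hx
  have h : MvPolynomial.eval (Projectivization.mk ℝ x hx).rep F
      = (a : ℝ) ^ q * MvPolynomial.eval x F := by
    rw [← ha]
    exact hF.eval_smul_eq (a : ℝ) x
  simp [zeroSet, h]

/-- The double cover of `ℝP²` by the unit sphere. -/
def ofSphere (x : Metric.sphere (0 : Fin 3 → ℝ) 1) : RP2 :=
  Projectivization.mk ℝ x.1 (ne_zero_of_mem_unit_sphere x)

lemma continuous_ofSphere : Continuous ofSphere :=
  (continuous_quotient_mk' (s := projectivizationSetoid ℝ (Fin 3 → ℝ))).comp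
    (continuous_subtype_val.subtype_mk ne_zero_of_mem_unit_sphere)

lemma ofSphere_surjective : Function.Surjective ofSphere := by
  intro p
  have hp : ‖p.rep‖ ≠ 0 := norm_ne_zero_iff.2 p.rep_nonzero
  refine ⟨⟨‖p.rep‖⁻¹ • p.rep, by simp [norm_smul, hp]⟩, ?_⟩
  conv_rhs => rw [← p.mk_rep]
  rw [ofSphere, Projectivization.mk_eq_mk_iff']
  exact ⟨‖p.rep‖⁻¹, rfl⟩

instance : CompactSpace RP2 :=
  ofSphere_surjective.compactSpace continuous_ofSphere

/-- The Veronese embedding `[x] ↦ x xᵀ / (x ⬝ x)`, the orthogonal projector onto the line. -/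
def projector : RP2 → Fin 3 → Fin 3 → ℝ :=
  Projectivization.lift (fun v i j => v.1 i * v.1 j / (v.1 ⬝ᵥ v.1)) <| by
    rintro ⟨v, hv⟩ ⟨w, hw⟩ t (rfl : v = t • w)
    have ht : t ≠ 0 := by
      rintro rfl
      simp at hv
    ext i j
    simp only [Pi.smul_apply, smul_eq_mul, smul_dotProduct, dotProduct_smul]
    rw [show t * w i * (t * w j) = (t * t) * (w i * w j) by ring, ← mul_assoc t t,
      mul_div_mul_left _ _ (mul_ne_zero ht ht)]

lemma continuous_projector : Continuous projector := by
  refine Continuous.quotient_lift (s := projectivizationSetoid ℝ (Fin 3 → ℝ)) ?_ _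
  refine continuous_pi fun i => continuous_pi fun j => Continuous.div ?_ ?_ ?_
  · exact ((continuous_apply i).comp continuous_subtype_val).mul
      ((continuous_apply j).comp continuous_subtype_val)
  · exact continuous_subtype_val.dotProduct continuous_subtype_val
  · exact fun v h => v.2 (dotProduct_self_eq_zero.1 h)

lemma projector_injective : Function.Injective projector := by
  intro p r
  induction p using Projectivization.ind with | h x hx
  induction r using Projectivization.ind with | h y hy
  intro h
  have hxy : ∀ i j, x i * x j / (x ⬝ᵥ x) = y i * y j / (y ⬝ᵥ y) :=
    fun i j => congrFun (congrFun h i) j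
  have hx2 : x ⬝ᵥ x ≠ 0 := fun h => hx (dotProduct_self_eq_zero.1 h)
  obtain ⟨j, hj⟩ := Function.ne_iff.1 hx
  simp only [Pi.zero_apply] at hj
  rw [Projectivization.mk_eq_mk_iff']
  refine ⟨y j / (y ⬝ᵥ y) * (x ⬝ᵥ x) / x j, ?_⟩
  ext i
  have h1 : x i * x j = y i * y j / (y ⬝ᵥ y) * (x ⬝ᵥ x) := (div_eq_iff hx2).1 (hxy i j)
  simp only [Pi.smul_apply, smul_eq_mul]
  rw [div_mul_eq_mul_div, div_eq_iff hj, h1]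
  ring

instance : T2Space RP2 :=
  T2Space.of_injective_continuous projector_injective continuous_projector

/-- Coefficient vectors of ternary forms of degree `q`. -/
abbrev Coeff (q : ℕ) : Type := (Finset.univ : Finset (Fin 3)).finsuppAntidiag q → ℝ

/-- The form of degree `q` with prescribed coefficients. -/
def form (q : ℕ) (c : Coeff q) :
    MvPolynomial (Fin 3) ℝ :=
  ∑ d, MvPolynomial.monomial d.1 (c d)

variable {q : ℕ}

lemma form_isHomogeneous (c : Coeff q) :
    (form q c).IsHomogeneous q := by
  refine MvPolynomial.IsHomogeneous.sum _ _ _ fun d _ => MvPolynomial.isHomogeneous_monomial _ ?_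
  rw [Finsupp.degree_eq_sum]
  exact (Finset.mem_finsuppAntidiag.1 d.2).1

lemma coeff_form (c : Coeff q)
    (d : (Finset.univ : Finset (Fin 3)).finsuppAntidiag q) :
    (form q c).coeff d.1 = c d := by
  classical
  simp [form, MvPolynomial.coeff_sum, MvPolynomial.coeff_monomial]

lemma form_ne_zero {c : Coeff q} (hc : c ≠ 0) :
    form q c ≠ 0 := by
  intro h
  refine hc (funext fun d => ?_)
  rw [← coeff_form c d, h]
  simp

lemma form_coeff {F : MvPolynomial (Fin 3) ℝ} (hF : F.IsHomogeneous q) :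
    form q (fun d => F.coeff d.1) = F := by
  ext d
  by_cases hd : d.degree = q
  · exact coeff_form _ ⟨d, by simpa [Finsupp.degree_eq_sum] using hd⟩
  · rw [(form_isHomogeneous _).coeff_eq_zero hd, hF.coeff_eq_zero hd]

lemma form_smul (a : ℝ) (c : Coeff q) :
    form q (a • c) = a • form q c := by
  simp [form, Finset.smul_sum, MvPolynomial.smul_monomial]

lemma continuous_eval_form :
    Continuous fun z : Coeff q × (Fin 3 → ℝ) =>
      MvPolynomial.eval z.2 (form q z.1) := by
  simp only [form, map_sum, MvPolynomial.eval_monomial, Finsupp.prod_fintype, pow_zero, implies_true]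
  fun_prop

lemma zeroSet_smul {a : ℝ} (ha : a ≠ 0) (F : MvPolynomial (Fin 3) ℝ) :
    zeroSet (a • F) = zeroSet F := by
  ext p
  simp [zeroSet, MvPolynomial.smul_eval, ha]

/-- Every curve of degree `q` is the zero set of a form whose coefficient vector is a unit
vector. -/
lemma exists_zeroSet_form_eq {F : MvPolynomial (Fin 3) ℝ} (hF : F.IsHomogeneous q) (h0 : F ≠ 0) :
    ∃ c ∈ Metric.sphere (0 : Coeff q) 1,
      zeroSet (form q c) = zeroSet F := by
  set c : Coeff q := fun d => F.coeff d.1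
  have hcF : form q c = F := form_coeff hF
  have hc0 : ‖c‖ ≠ 0 := by
    rw [norm_ne_zero_iff]
    intro h
    rw [h] at hcF
    exact h0 (by simp [← hcF, form])
  refine ⟨‖c‖⁻¹ • c, by simp [norm_smul, hc0], ?_⟩
  rw [form_smul, zeroSet_smul (inv_ne_zero hc0), hcF]

/-- The incidence relation between forms and points is closed. -/
lemma isClosed_incidence :
    IsClosed {z : Coeff q × RP2 |
      z.2 ∈ zeroSet (form q z.1)} := by
  have hmap := (isProperMap_id (X := Coeff q)).prodMap
    continuous_ofSphere.isProperMap
  convert hmap.isClosedMap _ (isClosed_singleton (x := (0 : ℝ)) |>.preimage <|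
    continuous_eval_form.comp (continuous_id.prodMap continuous_subtype_val))
  ext ⟨c, p⟩
  obtain ⟨x, rfl⟩ := ofSphere_surjective p
  have hmem : ∀ y, ofSphere y ∈ zeroSet (form q c) ↔ MvPolynomial.eval y.1 (form q c) = 0 :=
    fun y => mk_mem_zeroSet_iff (form_isHomogeneous c) y.1 _
  constructor
  · exact fun h => ⟨(c, x), (hmem x).1 h, rfl⟩
  · rintro ⟨⟨c', y⟩, hy, h⟩
    obtain ⟨rfl, hyx⟩ := Prod.mk.inj h
    change ofSphere x ∈ zeroSet (form q c')
    rw [← hyx]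
    exact (hmem y).2 hy

lemma isClosed_zeroSet_form (c : Coeff q) :
    IsClosed (zeroSet (form q c)) :=
  isClosed_incidence.preimage (Continuous.prodMk_right c)

/-- Upper semicontinuity of the real point set. -/
lemma isOpen_zeroSet_form_subset {O : Set RP2} (hO : IsOpen O) :
    IsOpen {c | zeroSet (form q c) ⊆ O} := by
  have h := isClosedMap_fst_of_compactSpace _
    (isClosed_incidence (q := q) |>.inter (hO.isClosed_compl.preimage continuous_snd))
  convert h.isOpen_compl
  ext c
  simp [subset_def]

end RP2

/-- Two points of a compact set in a Hausdorff space that lie in different connected components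
are separated by open sets covering the compact set. -/
lemma IsCompact.exists_isOpen_of_notMem_connectedComponentIn {X : Type*} [TopologicalSpace X]
    [T2Space X] {Z : Set X} (hZ : IsCompact Z) {x y : X} (hx : x ∈ Z) (hy : y ∈ Z)
    (hxy : y ∉ connectedComponentIn Z x) :
    ∃ U V : Set X, IsOpen U ∧ IsOpen V ∧ x ∈ U ∧ y ∈ V ∧ Z ⊆ U ∪ V ∧ Disjoint U V := by
  have := isCompact_iff_compactSpace.1 hZ
  have hy' : (⟨y, hy⟩ : Z) ∉ connectedComponent (⟨x, hx⟩ : Z) := fun h =>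
    hxy (connectedComponentIn_eq_image hx ▸ mem_image_of_mem _ h)
  rw [connectedComponent_eq_iInter_isClopen, mem_iInter, not_forall] at hy'
  obtain ⟨⟨T, hT, hxT⟩, hyT⟩ := hy'
  obtain ⟨U, V, hU, hV, hTU, hTV, hUV⟩ := SeparatedNhds.of_isCompact_isCompact
    (hT.isClosed.isCompact.image continuous_subtype_val)
    (hT.compl.isClosed.isCompact.image continuous_subtype_val)
    ((disjoint_image_iff Subtype.val_injective).2 disjoint_compl_right)
  refine ⟨U, V, hU, hV, hTU ⟨_, hxT, rfl⟩, hTV ⟨_, hyT, rfl⟩, fun z hz => ?_, hUV⟩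
  by_cases h : (⟨z, hz⟩ : Z) ∈ T
  · exact Or.inl (hTU ⟨_, h, rfl⟩)
  · exact Or.inr (hTV ⟨_, h, rfl⟩)

/-- If the curves with coefficients `c k` are connected and pass through the points `r k i`, then
the limits of these points lie in one component of the limit curve. -/
lemma RP2.inOneComponent_of_tendsto {q : ℕ} {ι κ : Type*} {l : Filter κ} [l.NeBot]
    {c : κ → RP2.Coeff q} {c₀ : RP2.Coeff q} {r : κ → ι → RP2} {p : ι → RP2} [Nonempty ι]
    (hc : Tendsto c l (𝓝 c₀)) (hr : Tendsto r l (𝓝 p))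
    (hconn : ∀ᶠ k in l, IsConnected (zeroSet (RP2.form q (c k))))
    (hmem : ∀ᶠ k in l, ∀ i, r k i ∈ zeroSet (RP2.form q (c k))) :
    inOneComponent (zeroSet (RP2.form q c₀)) (Set.range p) := by
  have hpt : ∀ i, Tendsto (fun k => r k i) l (𝓝 (p i)) := tendsto_pi_nhds.1 hr
  have hp : ∀ i, p i ∈ zeroSet (RP2.form q c₀) := by
    intro i
    have h : (c₀, p i) ∈ {z : RP2.Coeff q × RP2 | z.2 ∈ zeroSet (RP2.form q z.1)} :=
      RP2.isClosed_incidence.mem_of_tendsto (hc.prodMk_nhds (hpt i)) (hmem.mono fun _ h => h i)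
    rwa [Set.mem_ofPred_eq] at h
  obtain ⟨j⟩ := ‹Nonempty ι›
  refine ⟨p j, hp j, ?_⟩
  rintro _ ⟨i, rfl⟩
  by_contra hi
  obtain ⟨U, V, hU, hV, hjU, hiV, hcover, hUV⟩ :=
    (RP2.isClosed_zeroSet_form c₀).isCompact.exists_isOpen_of_notMem_connectedComponentIn
      (hp j) (hp i) hi
  have hO := hc.eventually ((RP2.isOpen_zeroSet_form_subset (hU.union hV)).mem_nhds hcover)
  obtain ⟨k, hk, hkm, hkO, hkU, hkV⟩ := (hconn.and (hmem.and (hO.and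
    (((hpt j).eventually (hU.mem_nhds hjU)).and ((hpt i).eventually (hV.mem_nhds hiV)))))).exists
  obtain ⟨z, -, hz⟩ := hk.isPreconnected U V hU hV hkO ⟨_, hkm j, hkU⟩ ⟨_, hkm i, hkV⟩
  exact hUV.notMem_of_mem_left hz.1 hz.2

/-- If the set of `n`-tuples of points of `ℝP²` lying on a nonempty connected real point set of
some real curve of degree `q` is dense in `(ℝP²)ⁿ`, then every `n`-tuple of points of `ℝP²` lies
in a single connected component of the real point set of some real curve of degree `q`. -/
theorem stmt_1 (q n : ℕ) (hq : 1 ≤ q) (hn : 1 ≤ n)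
    (hdense : Dense {p : Fin n → RP2 | ∃ F : MvPolynomial (Fin 3) ℝ, F ≠ 0 ∧
      F.IsHomogeneous q ∧ IsConnected (zeroSet F) ∧ ∀ i, p i ∈ zeroSet F}) :
    ∀ p : Fin n → RP2, ∃ F : MvPolynomial (Fin 3) ℝ, F ≠ 0 ∧
      F.IsHomogeneous q ∧ inOneComponent (zeroSet F) (Set.range p) := by
  intro p
  obtain ⟨u, hSu, hup⟩ := mem_closure_iff_ultrafilter.1 (hdense p)
  have hform : ∀ᶠ r in (u : Filter (Fin n → RP2)), ∃ c ∈ Metric.sphere (0 : RP2.Coeff q) 1,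
      IsConnected (zeroSet (RP2.form q c)) ∧ ∀ i, r i ∈ zeroSet (RP2.form q c) := by
    filter_upwards [hSu] with r ⟨F, hF0, hF, hconn, hmem⟩
    obtain ⟨c, hc, hcF⟩ := RP2.exists_zeroSet_form_eq hF hF0
    exact ⟨c, hc, by rwa [hcF], by rwa [hcF]⟩
  obtain ⟨c, hc⟩ := hform.choice
  obtain ⟨c₀, hc₀, hlim⟩ := (isCompact_sphere (0 : RP2.Coeff q) 1).ultrafilter_le_nhds'
    (u.map c) (hc.mono fun _ h => h.1)
  have : Nonempty (Fin n) := ⟨⟨0, hn⟩⟩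
  have hlim' : Tendsto c u (𝓝 c₀) := hlim
  exact ⟨RP2.form q c₀, RP2.form_ne_zero (ne_zero_of_mem_unit_sphere ⟨c₀, hc₀⟩),
    RP2.form_isHomogeneous c₀, RP2.inOneComponent_of_tendsto (r := id) hlim' hup
      (hc.mono fun _ h => h.2.1) (hc.mono fun _ h => h.2.2)⟩
end
end

section
/- Let q₁, q₂ ≥ 1 and n₁, n₂ ≥ 1 be integers. Suppose that every set of n₁ points of ℝP² lies in a connected component of the real point set Z(F₁) of some nonzero homogeneous polynomial F₁ ∈ ℝ[x₀,x₁,x₂] of degree q₁, and that every set of n₂ points of ℝP² lies in a connected component of Z(F₂) for some nonzero homogeneous F₂ of degree q₂. Then every set of n₁ + n₂ − 1 points of ℝP² lies in a connected component of Z(G) for some nonzero homogeneous polynomial G ∈ ℝ[x₀,x₁,x₂] of degree q₁ + q₂. -/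
noncomputable section

/-- The curve defined by a product is the union of the curves of the factors. -/
theorem zeroSet_mul (F G : MvPolynomial (Fin 3) ℝ) :
    zeroSet (F * G) = zeroSet F ∪ zeroSet G := by
  ext x
  simp [zeroSet]

/-- If `S` lies in a component of `Z`, `T` lies in a component of `W`, and `S` and `T` share a
point, then `S ∪ T` lies in a component of `Z ∪ W`. -/
theorem inOneComponent.union {Z W S T : Set RP2} {x : RP2} (hS : inOneComponent Z S)
    (hT : inOneComponent W T) (hxS : x ∈ S) (hxT : x ∈ T) :
    inOneComponent (Z ∪ W) (S ∪ T) := by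
  obtain ⟨a, -, hSa⟩ := hS
  obtain ⟨b, -, hTb⟩ := hT
  have hxa := hSa hxS
  have hxb := hTb hxT
  refine ⟨x, Or.inl (connectedComponentIn_subset _ _ hxa), Set.union_subset ?_ ?_⟩
  · rw [connectedComponentIn_eq hxa] at hSa
    exact hSa.trans (connectedComponentIn_mono _ Set.subset_union_left)
  · rw [connectedComponentIn_eq hxb] at hTb
    exact hTb.trans (connectedComponentIn_mono _ Set.subset_union_right)

/-- Additivity: if every `n₁` points of `ℝP²` lie in a connected component of a real curve of
degree `q₁`, and every `n₂` points lie in a connected component of a real curve of degree `q₂`,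
then every `n₁ + n₂ - 1` points lie in a connected component of a real curve of degree
`q₁ + q₂`. -/
theorem stmt_2 (q₁ q₂ n₁ n₂ : ℕ) (hq₁ : 1 ≤ q₁) (hq₂ : 1 ≤ q₂) (hn₁ : 1 ≤ n₁) (hn₂ : 1 ≤ n₂)
    (h₁ : ∀ p : Fin n₁ → RP2, ∃ F : MvPolynomial (Fin 3) ℝ, F ≠ 0 ∧
      F.IsHomogeneous q₁ ∧ inOneComponent (zeroSet F) (Set.range p))
    (h₂ : ∀ p : Fin n₂ → RP2, ∃ F : MvPolynomial (Fin 3) ℝ, F ≠ 0 ∧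
      F.IsHomogeneous q₂ ∧ inOneComponent (zeroSet F) (Set.range p)) :
    ∀ p : Fin (n₁ + n₂ - 1) → RP2, ∃ G : MvPolynomial (Fin 3) ℝ, G ≠ 0 ∧
      G.IsHomogeneous (q₁ + q₂) ∧ inOneComponent (zeroSet G) (Set.range p) := by
  intro p
  obtain ⟨F, hF0, hF, hFp⟩ := h₁ fun i => p ⟨i, by omega⟩
  obtain ⟨G, hG0, hG, hGp⟩ := h₂ fun j => p ⟨n₁ - 1 + j, by omega⟩
  refine ⟨F * G, mul_ne_zero hF0 hG0, hF.mul hG, ?_⟩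
  obtain ⟨c, hc, hsub⟩ := hFp.union hGp (x := p ⟨n₁ - 1, by omega⟩)
    ⟨⟨n₁ - 1, by omega⟩, rfl⟩ ⟨⟨0, by omega⟩, rfl⟩
  rw [zeroSet_mul]
  refine ⟨c, hc, Set.Subset.trans ?_ hsub⟩
  rintro _ ⟨k, rfl⟩
  by_cases hk : (k : ℕ) < n₁
  · exact Or.inl ⟨⟨k, hk⟩, rfl⟩
  · refine Or.inr ⟨⟨k - (n₁ - 1), by omega⟩, congrArg p (Fin.ext ?_)⟩
    simp only
    omega
end
end

section
/- For any 8 points p₁,…,p₈ ∈ ℝP² there exists a nonzero homogeneous polynomial F ∈ ℝ[x₀,x₁,x₂] of degree 3 such that some connected component of the real point set Z(F) contains all eight points (i.e. c'(3) ≥ 8). -/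
noncomputable section

open Set Filter Topology

/-- A path cannot run between two closed sets that cover it and are disjoint along it. -/
lemma false_of_path_between_closed {X : Type*} [TopologicalSpace X] {γ : ℝ → X}
    (hγ : Continuous γ) {A B : Set X} (hA : IsClosed A) (hB : IsClosed B)
    (hcov : ∀ t ∈ Icc (0 : ℝ) 1, γ t ∈ A ∨ γ t ∈ B)
    (hdisj : ∀ t ∈ Icc (0 : ℝ) 1, γ t ∈ A → γ t ∉ B) (h0 : γ 0 ∈ A) (h1 : γ 1 ∈ B) : False := by
  obtain ⟨t, ht, htA, htB⟩ := isPreconnected_closed_iff.1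
    (isPreconnected_Icc (a := (0 : ℝ)) (b := 1)) _ _ (hA.preimage hγ) (hB.preimage hγ) (fun t ht => hcov t ht)
    ⟨0, by simp, h0⟩ ⟨1, by simp, h1⟩
  exact hdisj t ht htA htB

/-- A binary quartic form cannot alternate in sign at six cyclically ordered directions. -/
lemma binary_quartic_not_alternating (d0 d1 d2 d3 d4 a b f : ℝ)
    (ha : 0 < a) (ha1 : a < 1) (hb : 0 < b) (hb1 : b < 1) (hf : 0 < f)
    (h1 : 0 ≤ d0) (h2 : d0 + d1 * a + d2 * a ^ 2 + d3 * a ^ 3 + d4 * a ^ 4 < 0)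
    (h3 : 0 ≤ d0 + d1 + d2 + d3 + d4)
    (h4 : d0 * b ^ 4 + d1 * b ^ 3 + d2 * b ^ 2 + d3 * b + d4 < 0) (h5 : 0 ≤ d4)
    (h6 : d0 - d1 * f + d2 * f ^ 2 - d3 * f ^ 3 + d4 * f ^ 4 < 0) : False := by
  have hab : 0 < 1 - a * b := by nlinarith
  have ha' : 0 < 1 - a := by linarith
  have hb' : 0 < 1 - b := by linarith
  have e1 := mul_nonneg (le_of_lt (show 0 <
    (1 - a) * (1 - a * b) * (f + a) * (1 - b) * (f + 1) * b * (b * f + 1) by positivity)) h1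
  have e2 := mul_neg_of_pos_of_neg (show 0 <
    f * (1 - b) * (f + 1) * b * (b * f + 1) by positivity) h2
  have e3 := mul_nonneg (le_of_lt (show 0 <
    a * f * (1 - a * b) * (f + a) * b * (b * f + 1) by positivity)) h3
  have e4 := mul_neg_of_pos_of_neg (show 0 <
    a * f * (1 - a) * (f + a) * (f + 1) by positivity) h4
  have e5 := mul_nonneg (le_of_lt (show 0 <
    a * f * (1 - a) * (1 - a * b) * (f + a) * (1 - b) * (f + 1) * (b * f + 1) by positivity)) h5
  have e6 := mul_neg_of_pos_of_neg (show 0 <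
    a * (1 - a) * (1 - a * b) * (1 - b) * b by positivity) h6
  linarith

/-- The zero set of `f` is covered by three closed cones that meet only at the origin. -/
structure ConeSplitting {X : Type*} [TopologicalSpace X] [AddCommGroup X] [Module ℝ X]
    (f : X → ℝ) (C : Fin 3 → Set X) : Prop where
  isClosed : ∀ i, IsClosed (C i)
  smul_mem : ∀ i (μ : ℝ) v, v ∈ C i → μ • v ∈ C i
  eq_zero : ∀ i j v, i ≠ j → v ∈ C i → v ∈ C j → v = 0
  cover : ∀ v, f v = 0 → ∃ i, v ∈ C i

/-- A ternary cubic form vanishing at `(1, 0, 0)`. -/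
def pointedCubic (k : Fin 9 → ℝ) (v : ℝ × ℝ × ℝ) : ℝ :=
  v.1 ^ 2 * (k 0 * v.2.1 + k 1 * v.2.2)
    + v.1 * (k 2 * v.2.1 ^ 2 + k 3 * v.2.1 * v.2.2 + k 4 * v.2.2 ^ 2)
    + (k 5 * v.2.1 ^ 3 + k 6 * v.2.1 ^ 2 * v.2.2 + k 7 * v.2.1 * v.2.2 ^ 2 + k 8 * v.2.2 ^ 3)

/-- The binary quadratic form in `r` cut out by the cubic on the line through `(1, 0, 0)` in
direction `s`, residual to `(1, 0, 0)`. -/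
def residualForm (k : Fin 9 → ℝ) (r s : ℝ × ℝ) : ℝ :=
  r.1 ^ 2 * (k 0 * s.1 + k 1 * s.2)
    + r.1 * r.2 * (k 2 * s.1 ^ 2 + k 3 * s.1 * s.2 + k 4 * s.2 ^ 2)
    + r.2 ^ 2 * (k 5 * s.1 ^ 3 + k 6 * s.1 ^ 2 * s.2 + k 7 * s.1 * s.2 ^ 2 + k 8 * s.2 ^ 3)

/-- The point with parameter `r` on the line through `(1, 0, 0)` in direction `s`. -/
def linePoint (r s : ℝ × ℝ) : ℝ × ℝ × ℝ := (r.1, r.2 * s.1, r.2 * s.2)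

/-- The discriminant of `residualForm k · s`. -/
def residualDisc (k : Fin 9 → ℝ) (s : ℝ × ℝ) : ℝ :=
  (k 2 * s.1 ^ 2 + k 3 * s.1 * s.2 + k 4 * s.2 ^ 2) ^ 2 - 4 * (k 0 * s.1 + k 1 * s.2) *
    (k 5 * s.1 ^ 3 + k 6 * s.1 ^ 2 * s.2 + k 7 * s.1 * s.2 ^ 2 + k 8 * s.2 ^ 3)

/-- The directions in which the residual intersection meets `A`. -/
def shadow (k : Fin 9 → ℝ) (A : Set (ℝ × ℝ × ℝ)) : Set (ℝ × ℝ) :=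
  {s | ∃ r, r ≠ 0 ∧ residualForm k r s = 0 ∧ linePoint r s ∈ A}

lemma continuous_linePoint : Continuous fun x : (ℝ × ℝ) × (ℝ × ℝ) => linePoint x.1 x.2 := by
  unfold linePoint; fun_prop

lemma continuous_residualForm (k : Fin 9 → ℝ) :
    Continuous fun x : (ℝ × ℝ) × (ℝ × ℝ) => residualForm k x.1 x.2 := by
  unfold residualForm; fun_prop

lemma linePoint_ne_zero {r s : ℝ × ℝ} (hr : r ≠ 0) (hs : s ≠ 0) : linePoint r s ≠ 0 := by
  intro h
  simp only [linePoint, Prod.mk_eq_zero, mul_eq_zero] at h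
  obtain ⟨h1, h2, h3⟩ := h
  by_cases hr2 : r.2 = 0
  · exact hr (Prod.ext h1 hr2)
  · exact hs (Prod.ext (h2.resolve_left hr2) (h3.resolve_left hr2))

lemma linePoint_smul (μ : ℝ) (r s : ℝ × ℝ) : linePoint (μ • r) s = μ • linePoint r s := by
  simp [linePoint, mul_assoc]

lemma residualForm_smul (k : Fin 9 → ℝ) (μ : ℝ) (r s : ℝ × ℝ) :
    residualForm k (μ • r) s = μ ^ 2 * residualForm k r s := by
  simp [residualForm]; ring

lemma pointedCubic_linePoint (k : Fin 9 → ℝ) (r s : ℝ × ℝ) :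
    pointedCubic k (linePoint r s) = r.2 * residualForm k r s := by
  simp [residualForm, pointedCubic, linePoint]; ring

lemma residualDisc_nonneg_of_root {k : Fin 9 → ℝ} {r s : ℝ × ℝ} (hr : r ≠ 0)
    (h : residualForm k r s = 0) : 0 ≤ residualDisc k s := by
  unfold residualForm at h
  unfold residualDisc
  set L := k 0 * s.1 + k 1 * s.2
  set Q := k 2 * s.1 ^ 2 + k 3 * s.1 * s.2 + k 4 * s.2 ^ 2
  set K := k 5 * s.1 ^ 3 + k 6 * s.1 ^ 2 * s.2 + k 7 * s.1 * s.2 ^ 2 + k 8 * s.2 ^ 3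
  by_cases hr2 : r.2 = 0
  · have hr1 : r.1 ≠ 0 := fun h1 => hr (Prod.ext h1 hr2)
    have hL : L = 0 := by
      rw [hr2] at h
      have : r.1 ^ 2 * L = 0 := by linarith
      exact (mul_eq_zero.1 this).resolve_left (pow_ne_zero 2 hr1)
    rw [hL]; nlinarith [sq_nonneg Q]
  · have hpos : 0 < r.2 ^ 2 := by positivity
    have : r.2 ^ 2 * (Q ^ 2 - 4 * L * K) = (2 * L * r.1 + Q * r.2) ^ 2 := by
      linear_combination (-4 * L) * h
    by_contra hneg
    push Not at hneg
    nlinarith [sq_nonneg (2 * L * r.1 + Q * r.2)]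

lemma exists_root_of_residualDisc_nonneg {k : Fin 9 → ℝ} {s : ℝ × ℝ}
    (h : 0 ≤ residualDisc k s) : ∃ r, r ≠ 0 ∧ residualForm k r s = 0 := by
  unfold residualDisc at h
  unfold residualForm
  set L := k 0 * s.1 + k 1 * s.2
  set Q := k 2 * s.1 ^ 2 + k 3 * s.1 * s.2 + k 4 * s.2 ^ 2
  set K := k 5 * s.1 ^ 3 + k 6 * s.1 ^ 2 * s.2 + k 7 * s.1 * s.2 ^ 2 + k 8 * s.2 ^ 3
  by_cases hL : L = 0
  · exact ⟨(1, 0), by simp, by simp [hL]⟩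
  · refine ⟨(-Q + √(Q ^ 2 - 4 * L * K), 2 * L), by simp [hL], ?_⟩
    have := Real.sq_sqrt h
    simp only
    linear_combination L * this

lemma isClosed_shadow (k : Fin 9 → ℝ) {A : Set (ℝ × ℝ × ℝ)} (hA : IsClosed A)
    (hsmul : ∀ (μ : ℝ) v, v ∈ A → μ • v ∈ A) : IsClosed (shadow k A) := by
  have hproj := isClosedMap_snd_of_compactSpace (X := Metric.sphere (0 : ℝ × ℝ) 1)
    (Y := ℝ × ℝ) {x | residualForm k x.1 x.2 = 0 ∧ linePoint x.1 x.2 ∈ A} (by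
      have hι : Continuous fun x : Metric.sphere (0 : ℝ × ℝ) 1 × (ℝ × ℝ) =>
        ((x.1 : ℝ × ℝ), x.2) := by fun_prop
      exact (isClosed_eq ((continuous_residualForm k).comp hι) continuous_const).inter
        (hA.preimage (continuous_linePoint.comp hι)))
  convert hproj using 1
  ext s
  constructor
  · rintro ⟨r, hr, h0, hm⟩
    refine ⟨(⟨‖r‖⁻¹ • r, by simp [norm_smul, hr]⟩, s), ⟨?_, ?_⟩, rfl⟩
    · simp [residualForm_smul, h0]
    · simpa [linePoint_smul] using hsmul _ _ hm
  · rintro ⟨⟨r, s⟩, ⟨h0, hm⟩, rfl⟩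
    exact ⟨r, ne_zero_of_mem_unit_sphere r, h0, hm⟩

lemma smul_mem_shadow {k : Fin 9 → ℝ} {A : Set (ℝ × ℝ × ℝ)} {s : ℝ × ℝ} (h : s ∈ shadow k A)
    {μ : ℝ} (hμ : μ ≠ 0) : μ • s ∈ shadow k A := by
  obtain ⟨r, hr, h0, hm⟩ := h
  refine ⟨(r.1, r.2 / μ), fun h => hr ?_, ?_, ?_⟩
  · simp only [Prod.mk_eq_zero, div_eq_zero_iff, hμ, or_false] at h
    exact Prod.ext h.1 h.2
  · have : residualForm k (r.1, r.2 / μ) (μ • s) = μ * residualForm k r s := by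
      simp [residualForm]; field_simp
    rw [this, h0, mul_zero]
  · have : linePoint (r.1, r.2 / μ) (μ • s) = linePoint r s := by
      simp only [linePoint, Prod.smul_fst, Prod.smul_snd, smul_eq_mul]
      field_simp
    rwa [this]

section Pointed

variable {k : Fin 9 → ℝ} {C : Fin 3 → Set (ℝ × ℝ × ℝ)}

/-- Mixed coefficient of the residual form. -/
def residualMixed (k : Fin 9 → ℝ) (r r' s : ℝ × ℝ) : ℝ :=
  residualForm k (r + r') s - residualForm k r s - residualForm k r' s

lemma residualForm_comb (k : Fin 9 → ℝ) (r r' s : ℝ × ℝ) (α β : ℝ) :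
    residualForm k (α • r + β • r') s =
      α ^ 2 * residualForm k r s + β ^ 2 * residualForm k r' s + α * β * residualMixed k r r' s := by
  simp [residualForm, residualMixed]; ring

lemma ConeSplitting.linePoint_cover (h : ConeSplitting (pointedCubic k) C) {r s : ℝ × ℝ}
    (h0 : residualForm k r s = 0) : ∃ i, linePoint r s ∈ C i :=
  h.cover _ (by rw [pointedCubic_linePoint, h0, mul_zero])

lemma ConeSplitting.not_proportional (h : ConeSplitting (pointedCubic k) C) {i j : Fin 3}
    (hij : i ≠ j) {r r' s : ℝ × ℝ} (hr : r ≠ 0) (hs : s ≠ 0)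
    (hi : linePoint r s ∈ C i) (hj : linePoint r' s ∈ C j) (hr' : r' ≠ 0)
    {α β : ℝ} (hαβ : α ≠ 0 ∨ β ≠ 0) : α • r + β • r' ≠ 0 := by
  intro h0
  by_cases hα : α = 0
  · have hβ := hαβ.resolve_left (not_not.2 hα)
    rw [hα, zero_smul, zero_add] at h0
    exact (smul_ne_zero hβ hr') h0
  · have : r = (-(β / α)) • r' := by
      have h1 : α⁻¹ • (α • r + β • r') = 0 := by rw [h0, smul_zero]
      rw [smul_add, smul_smul, smul_smul, inv_mul_cancel₀ hα, one_smul] at h1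
      rw [eq_neg_of_add_eq_zero_left h1, neg_smul]
      congr 2; field_simp
    have hmem : linePoint r s ∈ C j := by
      rw [this, linePoint_smul]; exact h.smul_mem _ _ _ hj
    exact linePoint_ne_zero hr hs (h.eq_zero i j _ hij hi hmem)

lemma isClosed_iUnion_ne {X : Type*} [TopologicalSpace X] {C : Fin 3 → Set X}
    (h : ∀ i, IsClosed (C i)) (i : Fin 3) : IsClosed (⋃ j ∈ {j | j ≠ i}, C j) :=
  (Set.toFinite _).isClosed_biUnion fun j _ => h j

lemma ConeSplitting.residualMixed_ne_zero (h : ConeSplitting (pointedCubic k) C) {i j : Fin 3}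
    (hij : i ≠ j) {r r' s : ℝ × ℝ} (hr : r ≠ 0) (hs : s ≠ 0) (hr' : r' ≠ 0)
    (h0 : residualForm k r s = 0) (h0' : residualForm k r' s = 0)
    (hi : linePoint r s ∈ C i) (hj : linePoint r' s ∈ C j) : residualMixed k r r' s ≠ 0 := by
  intro hB
  have hne : ∀ t : ℝ, linePoint ((1 - t) • r + t • r') s ≠ 0 := fun t =>
    linePoint_ne_zero (h.not_proportional hij hr hs hi hj hr' (by
      by_cases ht : t = 0
      · left; simp [ht]
      · exact Or.inr ht)) hs
  refine false_of_path_between_closed (γ := fun t : ℝ => linePoint ((1 - t) • r + t • r') s)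
    (continuous_linePoint.comp
      (by fun_prop : Continuous fun t : ℝ => ((1 - t) • r + t • r', s))) (h.isClosed i) (isClosed_iUnion_ne h.isClosed i)
    (fun t _ => ?_) (fun t _ hA hB' => ?_) (by simpa using hi) ?_
  · obtain ⟨l, hl⟩ := h.linePoint_cover (r := (1 - t) • r + t • r') (s := s)
      (by rw [residualForm_comb, h0, h0', hB]; ring)
    by_cases hli : l = i
    · left; rwa [← hli]
    · right; exact mem_biUnion (x := l) hli hl
  · simp only [mem_iUnion, exists_prop] at hB'
    obtain ⟨l, hli, hl⟩ := hB'
    exact hne t (h.eq_zero l i _ hli hl hA)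
  · exact mem_biUnion (x := j) hij.symm (by simpa using hj)

lemma ConeSplitting.eventually_mem_shadow (h : ConeSplitting (pointedCubic k) C) {i j : Fin 3}
    (hij : i ≠ j) {s : ℝ × ℝ} (hs : s ≠ 0) (hi : s ∈ shadow k (C i)) (hj : s ∈ shadow k (C j)) :
    ∀ᶠ s' in 𝓝 s, s' ∈ shadow k (C i) := by
  obtain ⟨r, hr, h0, hm⟩ := hi
  obtain ⟨r', hr', h0', hm'⟩ := hj
  have hB := h.residualMixed_ne_zero hij hr hs hr' h0 h0' hm hm'
  have hopen : IsOpen {x : ℝ × (ℝ × ℝ) |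
      linePoint (r + x.1 • r') x.2 ∉ ⋃ l ∈ {l | l ≠ i}, C l} :=
    ((isClosed_iUnion_ne h.isClosed i).preimage
      (continuous_linePoint.comp (by fun_prop :
        Continuous fun x : ℝ × (ℝ × ℝ) => (r + x.1 • r', x.2)))).isOpen_compl
  have hmem : ((0 : ℝ), s) ∈ {x : ℝ × (ℝ × ℝ) |
      linePoint (r + x.1 • r') x.2 ∉ ⋃ l ∈ {l | l ≠ i}, C l} := by
    simp only [mem_ofPred_eq, zero_smul, add_zero, mem_iUnion, exists_prop, not_exists, not_and]
    exact fun l hl hlm => linePoint_ne_zero hr hs (h.eq_zero l i _ hl hlm hm)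
  obtain ⟨ε, hε, hball⟩ := Metric.isOpen_iff.1 hopen _ hmem
  set δ := ε / 2 with hδ
  have hδ0 : 0 < δ := by positivity
  have hcont : ∀ t : ℝ, Continuous fun s' => residualForm k (r + t • r') s' := fun t =>
    (continuous_residualForm k).comp (by fun_prop : Continuous fun s' : ℝ × ℝ => (r + t • r', s'))
  have hval : ∀ t : ℝ, residualForm k (r + t • r') s = t * residualMixed k r r' s := fun t => by
    have := residualForm_comb k r r' s 1 t
    rw [one_smul, h0, h0'] at this
    rw [this]; ring
  have hsign : ∀ᶠ s' in 𝓝 s,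
      residualForm k (r + δ • r') s' * residualForm k (r + (-δ) • r') s' < 0 := by
    refine ((hcont δ).mul (hcont (-δ))).continuousAt.eventually_lt continuousAt_const ?_
    change residualForm k (r + δ • r') s * residualForm k (r + (-δ) • r') s < 0
    rw [hval, hval]
    have : 0 < (δ * residualMixed k r r' s) ^ 2 := by positivity
    nlinarith
  filter_upwards [hsign, Metric.ball_mem_nhds s hε] with s' hs' hs'ε
  have hcτ : Continuous fun t : ℝ => residualForm k (r + t • r') s' :=
    (continuous_residualForm k).comp (by fun_prop : Continuous fun t : ℝ => (r + t • r', s'))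
  obtain ⟨t, ht, ht0⟩ : ∃ t ∈ Icc (-δ) δ, residualForm k (r + t • r') s' = 0 := by
    rcases mul_neg_iff.1 hs' with ⟨h1, h2⟩ | ⟨h1, h2⟩
    · exact intermediate_value_Icc (by linarith) hcτ.continuousOn ⟨h2.le, h1.le⟩
    · exact intermediate_value_Icc' (by linarith) hcτ.continuousOn ⟨h1.le, h2.le⟩
  have hnot := @hball (t, s') (by
    rw [Metric.mem_ball, Prod.dist_eq, max_lt_iff]
    refine ⟨?_, hs'ε⟩
    rw [Real.dist_eq, sub_zero]
    exact (abs_le.2 ht).trans_lt (by linarith))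
  refine ⟨r + t • r', ?_, ht0, ?_⟩
  · simpa using h.not_proportional hij hr hs hm hm' hr' (α := 1) (β := t) (Or.inl one_ne_zero)
  · obtain ⟨l, hl⟩ := h.linePoint_cover ht0
    by_cases hli : l = i
    · rwa [← hli]
    · exact absurd (mem_biUnion (x := l) hli hl) hnot

lemma ConeSplitting.shadow_inter_three (h : ConeSplitting (pointedCubic k) C) {i j l : Fin 3}
    (hij : i ≠ j) (hil : i ≠ l) (hjl : j ≠ l) {s : ℝ × ℝ} (hs : s ≠ 0)
    (hi : s ∈ shadow k (C i)) (hj : s ∈ shadow k (C j)) : s ∉ shadow k (C l) := by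
  obtain ⟨r, hr, h0, hm⟩ := hi
  obtain ⟨r', hr', h0', hm'⟩ := hj
  rintro ⟨r'', hr'', h0'', hm''⟩
  have hB := h.residualMixed_ne_zero hij hr hs hr' h0 h0' hm hm'
  set Δ := r.1 * r'.2 - r.2 * r'.1 with hΔ
  have e : Δ • r'' = (r''.1 * r'.2 - r''.2 * r'.1) • r + (r.1 * r''.2 - r.2 * r''.1) • r' := by
    ext <;> simp [hΔ] <;> ring
  have hp1 : r''.1 * r'.2 - r''.2 * r'.1 ≠ 0 := fun h1 => by
    by_cases hr2 : r'.2 = 0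
    · have : r'.1 ≠ 0 := fun h' => hr' (Prod.ext h' hr2)
      refine h.not_proportional hjl hr' hs hm' hm'' hr'' (α := -r''.1) (β := r'.1) (Or.inr this) ?_
      ext <;> simp <;> linarith
    · refine h.not_proportional hjl hr' hs hm' hm'' hr'' (α := -r''.2) (β := r'.2) (Or.inr hr2) ?_
      ext <;> simp <;> linarith
  have hp2 : r.1 * r''.2 - r.2 * r''.1 ≠ 0 := fun h1 => by
    by_cases hr2 : r.2 = 0
    · have : r.1 ≠ 0 := fun h' => hr (Prod.ext h' hr2)
      refine h.not_proportional hil hr hs hm hm'' hr'' (α := -r''.1) (β := r.1) (Or.inr this) ?_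
      ext <;> simp <;> linarith
    · refine h.not_proportional hil hr hs hm hm'' hr'' (α := -r''.2) (β := r.2) (Or.inr hr2) ?_
      ext <;> simp <;> linarith
  have key := congrArg (fun v => residualForm k v s) e
  simp only [residualForm_comb, residualForm_smul, h0, h0', h0'', mul_zero, zero_add] at key
  exact mul_ne_zero (mul_ne_zero hp1 hp2) hB key.symm

lemma isPreconnected_plane_punctured : IsPreconnected ({0}ᶜ : Set (ℝ × ℝ)) :=
  (isConnected_compl_singleton_of_one_lt_rank (by simp [one_add_one_eq_two]) 0).isPreconnected

/-- The shadows of the three cones are pairwise disjoint away from the origin. -/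
lemma ConeSplitting.shadow_disjoint (h : ConeSplitting (pointedCubic k) C)
    (hne : ∀ i, ∃ s, s ≠ 0 ∧ s ∈ shadow k (C i)) {i j : Fin 3} (hij : i ≠ j) {s : ℝ × ℝ}
    (hs : s ≠ 0) (hi : s ∈ shadow k (C i)) : s ∉ shadow k (C j) := by
  intro hj
  obtain ⟨l, hil, hjl⟩ : ∃ l, i ≠ l ∧ j ≠ l := by
    clear hi hj; revert i j; decide
  obtain ⟨s', hs', hl⟩ := hne l
  have hcl : IsClosed (shadow k (C i) ∩ shadow k (C j)) :=
    (isClosed_shadow k (h.isClosed i) (h.smul_mem i)).inter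
      (isClosed_shadow k (h.isClosed j) (h.smul_mem j))
  have hsub : ({0}ᶜ : Set (ℝ × ℝ)) ⊆ interior (shadow k (C i) ∩ shadow k (C j)) := by
    refine isPreconnected_plane_punctured.subset_of_closure_inter_subset isOpen_interior
      ⟨s, hs, ?_⟩ ?_
    · exact mem_interior_iff_mem_nhds.2 ((h.eventually_mem_shadow hij hs hi hj).and
        (h.eventually_mem_shadow hij.symm hs hj hi))
    · rintro t ⟨ht, ht0⟩
      have ht' := hcl.closure_subset (closure_mono interior_subset ht)
      exact mem_interior_iff_mem_nhds.2 ((h.eventually_mem_shadow hij ht0 ht'.1 ht'.2).and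
        (h.eventually_mem_shadow hij.symm ht0 ht'.2 ht'.1))
  have hmem_both := interior_subset (hsub hs')
  exact h.shadow_inter_three hij hil hjl hs' hmem_both.1 hmem_both.2 hl

/-- Between directions in two different shadows the discriminant becomes negative. -/
lemma ConeSplitting.exists_residualDisc_neg (h : ConeSplitting (pointedCubic k) C)
    (hne : ∀ i, ∃ s, s ≠ 0 ∧ s ∈ shadow k (C i)) {i j : Fin 3} (hij : i ≠ j) {s s' : ℝ × ℝ}
    (hi : s ∈ shadow k (C i)) (hj : s' ∈ shadow k (C j))
    (hseg : ∀ t ∈ Icc (0 : ℝ) 1, (1 - t) • s + t • s' ≠ 0) :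
    ∃ t ∈ Ioo (0 : ℝ) 1, residualDisc k ((1 - t) • s + t • s') < 0 := by
  by_contra! hcon
  have hcl : ∀ l, IsClosed (shadow k (C l)) := fun l =>
    isClosed_shadow k (h.isClosed l) (h.smul_mem l)
  refine false_of_path_between_closed (γ := fun t : ℝ => (1 - t) • s + t • s') (by fun_prop)
    (hcl i) (isClosed_iUnion_ne hcl i) (fun t ht => ?_) (fun t ht hA hB => ?_)
    (by simpa using hi) (mem_biUnion (x := j) hij.symm (by simpa using hj))
  · obtain ⟨l, hl⟩ : ∃ l, (1 - t) • s + t • s' ∈ shadow k (C l) := by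
      rcases eq_or_lt_of_le ht.1 with rfl | h0
      · exact ⟨i, by simpa using hi⟩
      rcases eq_or_lt_of_le ht.2 with rfl | h1
      · exact ⟨j, by simpa using hj⟩
      obtain ⟨r, hr, hr0⟩ := exists_root_of_residualDisc_nonneg (hcon t ⟨h0, h1⟩)
      obtain ⟨l, hl⟩ := h.linePoint_cover hr0
      exact ⟨l, r, hr, hr0, hl⟩
    by_cases hli : l = i
    · left; rwa [← hli]
    · right; exact mem_biUnion (x := l) hli hl
  · simp only [mem_iUnion, exists_prop] at hB
    obtain ⟨l, hli, hl⟩ := hB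
    exact h.shadow_disjoint hne hli (hseg t ht) hl hA

lemma residualDisc_comb (k : Fin 9 → ℝ) (s s' : ℝ × ℝ) :
    ∃ d0 d1 d2 d3 d4 : ℝ, ∀ α β : ℝ, residualDisc k (α • s + β • s') =
      d0 * α ^ 4 + d1 * α ^ 3 * β + d2 * α ^ 2 * β ^ 2 + d3 * α * β ^ 3 + d4 * β ^ 4 := by
  obtain ⟨l0, l1, hL⟩ : ∃ l0 l1 : ℝ, ∀ α β : ℝ, k 0 * (α • s + β • s').1 +
      k 1 * (α • s + β • s').2 = l0 * α + l1 * β :=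
    ⟨k 0 * s.1 + k 1 * s.2, k 0 * s'.1 + k 1 * s'.2, fun α β => by simp; ring⟩
  obtain ⟨q0, q1, q2, hQ⟩ : ∃ q0 q1 q2 : ℝ, ∀ α β : ℝ, k 2 * (α • s + β • s').1 ^ 2 +
      k 3 * (α • s + β • s').1 * (α • s + β • s').2 + k 4 * (α • s + β • s').2 ^ 2 =
      q0 * α ^ 2 + q1 * α * β + q2 * β ^ 2 :=
    ⟨k 2 * s.1 ^ 2 + k 3 * s.1 * s.2 + k 4 * s.2 ^ 2,
      2 * k 2 * s.1 * s'.1 + k 3 * (s.1 * s'.2 + s'.1 * s.2) + 2 * k 4 * s.2 * s'.2,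
      k 2 * s'.1 ^ 2 + k 3 * s'.1 * s'.2 + k 4 * s'.2 ^ 2, fun α β => by simp; ring⟩
  obtain ⟨c0, c1, c2, c3, hK⟩ : ∃ c0 c1 c2 c3 : ℝ, ∀ α β : ℝ, k 5 * (α • s + β • s').1 ^ 3 +
      k 6 * (α • s + β • s').1 ^ 2 * (α • s + β • s').2 +
      k 7 * (α • s + β • s').1 * (α • s + β • s').2 ^ 2 + k 8 * (α • s + β • s').2 ^ 3 =
      c0 * α ^ 3 + c1 * α ^ 2 * β + c2 * α * β ^ 2 + c3 * β ^ 3 :=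
    ⟨k 5 * s.1 ^ 3 + k 6 * s.1 ^ 2 * s.2 + k 7 * s.1 * s.2 ^ 2 + k 8 * s.2 ^ 3,
      3 * k 5 * s.1 ^ 2 * s'.1 + k 6 * (2 * s.1 * s'.1 * s.2 + s.1 ^ 2 * s'.2)
        + k 7 * (2 * s.1 * s.2 * s'.2 + s'.1 * s.2 ^ 2) + 3 * k 8 * s.2 ^ 2 * s'.2,
      3 * k 5 * s.1 * s'.1 ^ 2 + k 6 * (2 * s.1 * s'.1 * s'.2 + s'.1 ^ 2 * s.2)
        + k 7 * (2 * s'.1 * s.2 * s'.2 + s.1 * s'.2 ^ 2) + 3 * k 8 * s.2 * s'.2 ^ 2,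
      k 5 * s'.1 ^ 3 + k 6 * s'.1 ^ 2 * s'.2 + k 7 * s'.1 * s'.2 ^ 2 + k 8 * s'.2 ^ 3,
      fun α β => by simp; ring⟩
  refine ⟨q0 ^ 2 - 4 * l0 * c0, 2 * q0 * q1 - 4 * (l0 * c1 + l1 * c0),
    q1 ^ 2 + 2 * q0 * q2 - 4 * (l0 * c2 + l1 * c1), 2 * q1 * q2 - 4 * (l0 * c3 + l1 * c2),
    q2 ^ 2 - 4 * l1 * c3, fun α β => ?_⟩
  unfold residualDisc
  rw [hL, hQ, hK]
  ring

lemma ConeSplitting.shadow_nonempty (h : ConeSplitting (pointedCubic k) C)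
    (h0 : (1, 0, 0) ∈ C 0) (hC : ∀ j ≠ 0, ∃ v ∈ C j, v ≠ 0 ∧ pointedCubic k v = 0) (i : Fin 3) :
    ∃ s, s ≠ 0 ∧ s ∈ shadow k (C i) := by
  by_cases hi : i = 0
  · subst hi
    by_cases hk : k 0 = 0 ∧ k 1 = 0
    · exact ⟨(1, 0), by simp, (1, 0), by simp, by simp [residualForm, hk.1],
        by simpa [linePoint] using h0⟩
    · refine ⟨(k 1, -k 0), fun h' => hk ?_, (1, 0), by simp, ?_, by simpa [linePoint] using h0⟩
      · simp only [Prod.mk_eq_zero, neg_eq_zero] at h'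
        exact h'.symm
      · simp [residualForm]; ring
  · obtain ⟨v, hv, hv0, hvk⟩ := hC i hi
    refine ⟨v.2, fun h2 => hv0 ?_, (v.1, 1), by simp, ?_, by simpa [linePoint] using hv⟩
    · refine h.eq_zero i 0 v hi hv ?_
      have : v = v.1 • ((1, 0, 0) : ℝ × ℝ × ℝ) := by
        ext <;> simp [h2]
      rw [this]
      exact h.smul_mem _ _ _ h0
    · rw [← hvk]; simp [residualForm, pointedCubic]

/-- A cubic through `(1, 0, 0)` does not split into three nontrivial closed cones. -/
lemma ConeSplitting.false_of_pointed (h : ConeSplitting (pointedCubic k) C)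
    (h0 : (1, 0, 0) ∈ C 0) (hC : ∀ j ≠ 0, ∃ v ∈ C j, v ≠ 0 ∧ pointedCubic k v = 0) : False := by
  have hne := h.shadow_nonempty h0 hC
  obtain ⟨s₀, hs₀, hm₀⟩ := hne 0
  obtain ⟨s₁, hs₁, hm₁⟩ := hne 1
  obtain ⟨s₂, hs₂, hm₂⟩ := hne 2
  have hindep : ∀ {i j : Fin 3} {s s' : ℝ × ℝ}, i ≠ j → s ≠ 0 → s' ≠ 0 → s ∈ shadow k (C i) →
      s' ∈ shadow k (C j) → ∀ {x y : ℝ}, x • s + y • s' = 0 → x = 0 ∧ y = 0 := by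
    intro i j s s' hij hs hs' hi hj x y hxy
    by_cases hx : x = 0
    · subst hx
      simpa [hs'] using hxy
    · exfalso
      have hy : y ≠ 0 := fun hy => by
        subst hy
        simp [hs, hx] at hxy
      have hj' := smul_mem_shadow hj (neg_ne_zero.2 hy)
      have heq : (-y) • s' = x • s := by
        rw [neg_smul]; exact (eq_neg_of_add_eq_zero_left hxy).symm
      rw [heq] at hj'
      exact h.shadow_disjoint hne hij (smul_ne_zero hx hs) (smul_mem_shadow hi hx) hj'
  set Δ := s₀.1 * s₁.2 - s₀.2 * s₁.1 with hΔ
  set α := s₂.1 * s₁.2 - s₂.2 * s₁.1 with hα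
  set β := s₀.1 * s₂.2 - s₀.2 * s₂.1 with hβ
  have hdet : ∀ {i j : Fin 3} {s s' : ℝ × ℝ}, i ≠ j → s ≠ 0 → s' ≠ 0 → s ∈ shadow k (C i) →
      s' ∈ shadow k (C j) → s.1 * s'.2 - s.2 * s'.1 ≠ 0 := by
    intro i j s s' hij hs hs' hi hj hd
    have h1 := hindep hij hs hs' hi hj (x := s'.2) (y := -s.2) (by
      ext <;> simp <;> linarith)
    have h2 := hindep hij hs hs' hi hj (x := s'.1) (y := -s.1) (by
      ext <;> simp <;> linarith)
    exact hs' (Prod.ext h2.1 h1.1)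
  have hΔ0 : Δ ≠ 0 := hdet (by decide : (0 : Fin 3) ≠ 1) hs₀ hs₁ hm₀ hm₁
  have hα0 : α ≠ 0 := hdet (by decide : (2 : Fin 3) ≠ 1) hs₂ hs₁ hm₂ hm₁
  have hβ0 : β ≠ 0 := hdet (by decide : (0 : Fin 3) ≠ 2) hs₀ hs₂ hm₀ hm₂
  obtain ⟨a, ha⟩ : ∃ a, a = α • s₀ := ⟨_, rfl⟩
  obtain ⟨b, hb⟩ : ∃ b, b = β • s₁ := ⟨_, rfl⟩
  have ha0 : a ≠ 0 := ha ▸ smul_ne_zero hα0 hs₀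
  have hb0 : b ≠ 0 := hb ▸ smul_ne_zero hβ0 hs₁
  have hma : a ∈ shadow k (C 0) := ha ▸ smul_mem_shadow hm₀ hα0
  have hmb : b ∈ shadow k (C 1) := hb ▸ smul_mem_shadow hm₁ hβ0
  have hmb' : -b ∈ shadow k (C 1) := by
    simpa using smul_mem_shadow hmb (neg_ne_zero.2 one_ne_zero)
  have hmab : a + b ∈ shadow k (C 2) := by
    have : a + b = Δ • s₂ := by
      ext <;> simp [ha, hb, hα, hβ, hΔ] <;> ring
    rw [this]
    exact smul_mem_shadow hm₂ hΔ0
  have hab : ∀ {x y : ℝ}, x • a + y • b = 0 → x = 0 ∧ y = 0 := fun hxy =>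
    hindep (by decide : (0 : Fin 3) ≠ 1) ha0 hb0 hma hmb hxy
  have e1 : ∀ t : ℝ, (1 - t) • a + t • (a + b) = (1 : ℝ) • a + t • b := fun t => by module
  have e2 : ∀ t : ℝ, (1 - t) • b + t • (a + b) = t • a + (1 : ℝ) • b := fun t => by module
  have e3 : ∀ t : ℝ, (1 - t) • a + t • (-b) = (1 - t) • a + (-t) • b := fun t => by module
  obtain ⟨t₁, ht₁, hD₁⟩ := h.exists_residualDisc_neg hne (by decide : (0 : Fin 3) ≠ 2) hma hmab
    fun t _ ht0 => one_ne_zero (hab (e1 t ▸ ht0)).1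
  obtain ⟨t₂, ht₂, hD₂⟩ := h.exists_residualDisc_neg hne (by decide : (1 : Fin 3) ≠ 2) hmb hmab
    fun t _ ht0 => one_ne_zero (hab (e2 t ▸ ht0)).2
  obtain ⟨t₃, ht₃, hD₃⟩ := h.exists_residualDisc_neg hne (by decide : (0 : Fin 3) ≠ 1) hma hmb'
    fun t _ ht0 => by
      have := hab (e3 t ▸ ht0)
      linarith [this.1, this.2]
  obtain ⟨d0, d1, d2, d3, d4, hd⟩ := residualDisc_comb k a b
  have hnonneg : ∀ {i : Fin 3} {s : ℝ × ℝ}, s ∈ shadow k (C i) → 0 ≤ residualDisc k s :=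
    fun ⟨_, hr, hr0, _⟩ => residualDisc_nonneg_of_root hr hr0
  have n1 := hnonneg hma
  have n2 := hnonneg hmb
  have n3 := hnonneg hmab
  rw [show a = (1 : ℝ) • a + (0 : ℝ) • b by module, hd] at n1
  rw [show b = (0 : ℝ) • a + (1 : ℝ) • b by module, hd] at n2
  rw [show a + b = (1 : ℝ) • a + (1 : ℝ) • b by module, hd] at n3
  rw [e1, hd] at hD₁
  rw [e2, hd] at hD₂
  rw [e3, hd] at hD₃
  have hpos : 0 < 1 - t₃ := by linarith [ht₃.2]
  refine binary_quartic_not_alternating d0 d1 d2 d3 d4 t₁ t₂ (t₃ / (1 - t₃)) ht₁.1 ht₁.2 ht₂.1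
    ht₂.2 (div_pos ht₃.1 hpos) (by linarith) (by linarith) (by linarith) (by linarith)
    (by linarith) ?_
  have : d0 - d1 * (t₃ / (1 - t₃)) + d2 * (t₃ / (1 - t₃)) ^ 2 - d3 * (t₃ / (1 - t₃)) ^ 3
      + d4 * (t₃ / (1 - t₃)) ^ 4 = (d0 * (1 - t₃) ^ 4 + d1 * (1 - t₃) ^ 3 * -t₃
      + d2 * (1 - t₃) ^ 2 * (-t₃) ^ 2 + d3 * (1 - t₃) * (-t₃) ^ 3 + d4 * (-t₃) ^ 4)
      / (1 - t₃) ^ 4 := by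
    field_simp
    ring
  rw [this]
  exact div_neg_of_neg_of_pos hD₃ (by positivity)

end Pointed

/-- The ternary cubic form with coefficient vector `c`. -/
def cubicForm (c : Fin 10 → ℝ) (v : Fin 3 → ℝ) : ℝ :=
  c 0 * v 0 ^ 3 + c 1 * v 0 ^ 2 * v 1 + c 2 * v 0 ^ 2 * v 2 + c 3 * v 0 * v 1 ^ 2
    + c 4 * v 0 * v 1 * v 2 + c 5 * v 0 * v 2 ^ 2 + c 6 * v 1 ^ 3 + c 7 * v 1 ^ 2 * v 2
    + c 8 * v 1 * v 2 ^ 2 + c 9 * v 2 ^ 3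

lemma cubicForm_smul (c : Fin 10 → ℝ) (μ : ℝ) (v : Fin 3 → ℝ) :
    cubicForm c (μ • v) = μ ^ 3 * cubicForm c v := by
  simp [cubicForm]; ring

lemma cubicForm_smul_left (c : Fin 10 → ℝ) (μ : ℝ) (v : Fin 3 → ℝ) :
    cubicForm (μ • c) v = μ * cubicForm c v := by
  simp [cubicForm]; ring

lemma cubicForm_add_left (c c' : Fin 10 → ℝ) (v : Fin 3 → ℝ) :
    cubicForm (c + c') v = cubicForm c v + cubicForm c' v := by
  simp [cubicForm]; ring

lemma continuous_cubicForm :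
    Continuous fun x : (Fin 10 → ℝ) × (Fin 3 → ℝ) => cubicForm x.1 x.2 := by
  unfold cubicForm; fun_prop

/-- In a frame whose first vector lies on the cubic, the cubic has pointed form. -/
lemma exists_pointedCubic (c : Fin 10 → ℝ) (p a b : Fin 3 → ℝ) (hp : cubicForm c p = 0) :
    ∃ k : Fin 9 → ℝ, ∀ v : ℝ × ℝ × ℝ,
      cubicForm c (v.1 • p + v.2.1 • a + v.2.2 • b) = pointedCubic k v := by
  -- `P u w` is the derivative of the cubic at `u` in the direction `w`
  let P : (Fin 3 → ℝ) → (Fin 3 → ℝ) → ℝ := fun u w =>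
    w 0 * (3 * c 0 * u 0 ^ 2 + 2 * c 1 * u 0 * u 1 + 2 * c 2 * u 0 * u 2 + c 3 * u 1 ^ 2
        + c 4 * u 1 * u 2 + c 5 * u 2 ^ 2)
      + w 1 * (c 1 * u 0 ^ 2 + 2 * c 3 * u 0 * u 1 + c 4 * u 0 * u 2 + 3 * c 6 * u 1 ^ 2
        + 2 * c 7 * u 1 * u 2 + c 8 * u 2 ^ 2)
      + w 2 * (c 2 * u 0 ^ 2 + c 4 * u 0 * u 1 + 2 * c 5 * u 0 * u 2 + c 7 * u 1 ^ 2
        + 2 * c 8 * u 1 * u 2 + 3 * c 9 * u 2 ^ 2)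
  refine ⟨![P p a, P p b, P a p, P (a + b) p - P a p - P b p, P b p,
    cubicForm c a, P a b, P b a, cubicForm c b], fun v => ?_⟩
  have : cubicForm c (v.1 • p + v.2.1 • a + v.2.2 • b) = v.1 ^ 3 * cubicForm c p +
      pointedCubic ![P p a, P p b, P a p, P (a + b) p - P a p - P b p, P b p,
        cubicForm c a, P a b, P b a, cubicForm c b] v := by
    simp [pointedCubic, cubicForm, P]
    ring
  rw [this, hp]
  ring

lemma exists_frame {p : Fin 3 → ℝ} (hp : p ≠ 0) :
    ∃ a b : Fin 3 → ℝ, ∀ v, ∃ w : ℝ × ℝ × ℝ, w.1 • p + w.2.1 • a + w.2.2 • b = v := by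
  obtain ⟨i, hi⟩ := Function.ne_iff.1 hp
  simp only [Pi.zero_apply] at hi
  refine ⟨Pi.single (i + 1) 1, Pi.single (i + 2) 1, fun v => ⟨(v i / p i,
    v (i + 1) - v i / p i * p (i + 1), v (i + 2) - v i / p i * p (i + 2)), ?_⟩⟩
  fin_cases i <;> ext j <;> fin_cases j <;> simp_all

lemma ConeSplitting.false_of_cubicForm {c : Fin 10 → ℝ} {C : Fin 3 → Set (Fin 3 → ℝ)}
    (h : ConeSplitting (cubicForm c) C) (hC : ∀ i, ∃ v ∈ C i, v ≠ 0 ∧ cubicForm c v = 0) :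
    False := by
  obtain ⟨p, hpC, hp0, hpc⟩ := hC 0
  obtain ⟨a, b, hsurj⟩ := exists_frame hp0
  obtain ⟨k, hk⟩ := exists_pointedCubic c p a b hpc
  let φ : (ℝ × ℝ × ℝ) →ₗ[ℝ] (Fin 3 → ℝ) :=
    { toFun := fun v => v.1 • p + v.2.1 • a + v.2.2 • b
      map_add' := fun v w => by simp; module
      map_smul' := fun μ v => by simp; module }
  have hφ : Function.Surjective φ := hsurj
  have hinj : Function.Injective φ :=
    (LinearMap.injective_iff_surjective_of_finrank_eq_finrank (by simp)).2 hφ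
  have hcont : Continuous φ := φ.continuous_of_finiteDimensional
  refine ConeSplitting.false_of_pointed (k := k) (C := fun i => φ ⁻¹' C i)
    ⟨fun i => (h.isClosed i).preimage hcont, fun i μ v hv => ?_, fun i j v hij hi hj => ?_,
      fun v hv => ?_⟩ ?_ ?_
  · simpa using h.smul_mem i μ _ hv
  · exact hinj (by rw [h.eq_zero i j _ hij hi hj, map_zero])
  · exact h.cover _ ((hk v).trans hv)
  · simpa [φ] using hpC
  · intro j _
    obtain ⟨v, hv, hv0, hvc⟩ := hC j
    obtain ⟨w, rfl⟩ := hφ v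
    exact ⟨w, hv, fun hw => hv0 (by rw [hw, map_zero]), (hk w).symm.trans hvc⟩

/-! ### Topology of the projective plane -/

/-- The projection from nonzero vectors to the projective plane. -/
def toRP2 (v : {v : Fin 3 → ℝ // v ≠ 0}) : RP2 := Projectivization.mk ℝ v.1 v.2

lemma toRP2_eq_iff {v w : {v : Fin 3 → ℝ // v ≠ 0}} :
    toRP2 v = toRP2 w ↔ ∃ μ : ℝ, μ • w.1 = v.1 :=
  Projectivization.mk_eq_mk_iff' ℝ _ _ v.2 w.2

lemma toRP2_smul (v : {v : Fin 3 → ℝ // v ≠ 0}) {μ : ℝ} (hμ : μ ≠ 0) :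
    toRP2 ⟨μ • v.1, smul_ne_zero hμ v.2⟩ = toRP2 v :=
  toRP2_eq_iff.2 ⟨μ, rfl⟩

lemma isOpenQuotientMap_toRP2 : IsOpenQuotientMap toRP2 := by
  have hq : IsQuotientMap toRP2 := isQuotientMap_quotient_mk'
  refine ⟨hq.surjective, hq.continuous, fun U hU => ?_⟩
  rw [← hq.isOpen_preimage]
  have : toRP2 ⁻¹' (toRP2 '' U) = ⋃ μ : {μ : ℝ // μ ≠ 0},
      (fun v : {v : Fin 3 → ℝ // v ≠ 0} =>
        (⟨μ.1 • v.1, smul_ne_zero μ.2 v.2⟩ : {v : Fin 3 → ℝ // v ≠ 0})) ⁻¹' U := by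
    ext v
    simp only [mem_preimage, mem_image, mem_iUnion]
    constructor
    · rintro ⟨w, hw, hwv⟩
      obtain ⟨μ, hμ⟩ := toRP2_eq_iff.1 hwv
      have hμ0 : μ ≠ 0 := fun h0 => w.2 (by rw [← hμ, h0, zero_smul])
      refine ⟨⟨μ, hμ0⟩, ?_⟩
      convert hw
    · rintro ⟨μ, hμ⟩
      exact ⟨_, hμ, toRP2_smul v μ.2⟩
  rw [this]
  exact isOpen_iUnion fun μ => hU.preimage (by fun_prop)

instance : T2Space RP2 := by
  rw [t2Space_iff_of_isOpenQuotientMap isOpenQuotientMap_toRP2]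
  have : {q : {v : Fin 3 → ℝ // v ≠ 0} × {v : Fin 3 → ℝ // v ≠ 0} | toRP2 q.1 = toRP2 q.2} =
      {q | ∀ i j, q.1.1 i * q.2.1 j = q.1.1 j * q.2.1 i} := by
    ext ⟨v, w⟩
    simp only [mem_ofPred_eq, toRP2_eq_iff]
    constructor
    · rintro ⟨μ, hμ⟩ i j
      rw [← hμ]; simp; ring
    · intro h
      obtain ⟨i, hi⟩ := Function.ne_iff.1 w.2
      simp only [Pi.zero_apply] at hi
      refine ⟨v.1 i / w.1 i, ?_⟩
      ext j
      have := h i j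
      simp only [Pi.smul_apply, smul_eq_mul]
      field_simp
      linarith
  rw [this]
  simp only [ofPred_forall]
  have h₁ : ∀ i, Continuous fun q : {v : Fin 3 → ℝ // v ≠ 0} × {v : Fin 3 → ℝ // v ≠ 0} =>
      q.1.1 i := fun i => (continuous_apply i).comp (continuous_subtype_val.comp continuous_fst)
  have h₂ : ∀ i, Continuous fun q : {v : Fin 3 → ℝ // v ≠ 0} × {v : Fin 3 → ℝ // v ≠ 0} =>
      q.2.1 i := fun i => (continuous_apply i).comp (continuous_subtype_val.comp continuous_snd)
  exact isClosed_iInter fun i => isClosed_iInter fun j =>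
    isClosed_eq ((h₁ i).mul (h₂ j)) ((h₁ j).mul (h₂ i))

instance : CompactSpace RP2 := by
  let f : Metric.sphere (0 : Fin 3 → ℝ) 1 → RP2 := fun v =>
    toRP2 ⟨v.1, ne_zero_of_mem_unit_sphere v⟩
  have hf : Continuous f := isOpenQuotientMap_toRP2.continuous.comp (by fun_prop)
  refine ⟨?_⟩
  have hs : Function.Surjective f := by
    intro x
    obtain ⟨v, rfl⟩ := isOpenQuotientMap_toRP2.surjective x
    exact ⟨⟨‖v.1‖⁻¹ • v.1, by simp [norm_smul, v.2]⟩,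
      toRP2_smul v (inv_ne_zero (norm_ne_zero_iff.2 v.2))⟩
  rw [← hs.range_eq]
  exact isCompact_range hf

instance : PreconnectedSpace RP2 := by
  have : PreconnectedSpace {v : Fin 3 → ℝ // v ≠ 0} :=
    isPreconnected_iff_preconnectedSpace.1
      (isConnected_compl_singleton_of_one_lt_rank (E := Fin 3 → ℝ) (by simp) 0).isPreconnected
  exact isOpenQuotientMap_toRP2.surjective.denseRange.preconnectedSpace
    isOpenQuotientMap_toRP2.continuous

/-! ### Zero sets of cubics -/

/-- The real point set of the cubic with coefficient vector `c`. -/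
def cubicZeros (c : Fin 10 → ℝ) : Set RP2 := {x | cubicForm c x.rep = 0}

lemma toRP2_mem_cubicZeros {c : Fin 10 → ℝ} {v : {v : Fin 3 → ℝ // v ≠ 0}} :
    toRP2 v ∈ cubicZeros c ↔ cubicForm c v.1 = 0 := by
  obtain ⟨μ, hμ⟩ := Projectivization.exists_smul_eq_mk_rep ℝ v.1 v.2
  change cubicForm c (Projectivization.mk ℝ v.1 v.2).rep = 0 ↔ _
  rw [← hμ, Units.smul_def, cubicForm_smul]
  simp

lemma isClosed_cubicIncidence : IsClosed {x : (Fin 10 → ℝ) × RP2 | x.2 ∈ cubicZeros x.1} := by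
  have hq : IsOpenQuotientMap (Prod.map (id : (Fin 10 → ℝ) → _) toRP2) :=
    IsOpenQuotientMap.id.prodMap isOpenQuotientMap_toRP2
  rw [← hq.isQuotientMap.isClosed_preimage]
  have : Prod.map (id : (Fin 10 → ℝ) → _) toRP2 ⁻¹' {x | x.2 ∈ cubicZeros x.1} =
      {x | cubicForm x.1 x.2.1 = 0} := by
    ext ⟨c, v⟩
    exact toRP2_mem_cubicZeros
  rw [this]
  exact isClosed_eq (continuous_cubicForm.comp (by fun_prop :
    Continuous fun x : (Fin 10 → ℝ) × {v : Fin 3 → ℝ // v ≠ 0} => (x.1, x.2.1))) continuous_const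

lemma isClosed_cubicZeros (c : Fin 10 → ℝ) : IsClosed (cubicZeros c) :=
  isClosed_cubicIncidence.preimage (by fun_prop : Continuous fun x : RP2 => (c, x))

lemma cubicZeros_smul {c : Fin 10 → ℝ} {μ : ℝ} (hμ : μ ≠ 0) :
    cubicZeros (μ • c) = cubicZeros c := by
  ext x
  simp [cubicZeros, cubicForm_smul_left, hμ]

/-- Points in different components of a closed subset of a compact Hausdorff space can be
separated by disjoint open sets that cover it. -/
lemma exists_separation {X : Type*} [TopologicalSpace X] [CompactSpace X] [T2Space X] {Z : Set X}
    (hZ : IsClosed Z) {x y : X} (hx : x ∈ Z) (hy : y ∈ Z) (hxy : y ∉ connectedComponentIn Z x) :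
    ∃ U V : Set X, IsOpen U ∧ IsOpen V ∧ Disjoint U V ∧ Z ⊆ U ∪ V ∧ x ∈ U ∧ y ∈ V := by
  have : CompactSpace Z := isCompact_iff_compactSpace.1 hZ.isCompact
  have hxy' : (⟨y, hy⟩ : Z) ∉ connectedComponent (⟨x, hx⟩ : Z) := fun h =>
    hxy (by rw [connectedComponentIn_eq_image hx]; exact ⟨_, h, rfl⟩)
  rw [connectedComponent_eq_iInter_isClopen] at hxy'
  simp only [mem_iInter, not_forall] at hxy'
  obtain ⟨⟨s, hs, hxs⟩, hys⟩ := hxy'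
  obtain ⟨U, V, hU, hV, hsU, hsV, hUV⟩ := normal_separation
    (hZ.isClosedEmbedding_subtypeVal.isClosedMap _ hs.isClosed)
    (hZ.isClosedEmbedding_subtypeVal.isClosedMap _ hs.compl.isClosed)
    ((disjoint_image_iff Subtype.val_injective).2 disjoint_compl_right)
  refine ⟨U, V, hU, hV, hUV, fun z hz => ?_, hsU ⟨_, hxs, rfl⟩, hsV ⟨_, hys, rfl⟩⟩
  by_cases hzs : (⟨z, hz⟩ : Z) ∈ s
  · exact Or.inl (hsU ⟨_, hzs, rfl⟩)
  · exact Or.inr (hsV ⟨_, hzs, rfl⟩)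

lemma notMem_connectedComponentIn_of_separation {X : Type*} [TopologicalSpace X] {Z U V : Set X}
    (hU : IsOpen U) (hV : IsOpen V) (hUV : Disjoint U V) (hZ : Z ⊆ U ∪ V) {x y : X}
    (hx : x ∈ U) (hy : y ∈ V) : y ∉ connectedComponentIn Z x := by
  intro h
  have hxZ : x ∈ Z := by
    by_contra hxZ
    rw [connectedComponentIn_eq_empty hxZ] at h
    exact h
  have := isPreconnected_connectedComponentIn.subset_left_of_subset_union hU hV hUV
    ((connectedComponentIn_subset Z x).trans hZ) ⟨x, mem_connectedComponentIn hxZ, hx⟩ h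
  exact hUV.le_bot ⟨this, hy⟩

/-- Being in different components is an open condition on the cubic and the two points. -/
lemma eventually_notMem_connectedComponentIn {c : Fin 10 → ℝ} {x y : RP2}
    (hx : x ∈ cubicZeros c) (hy : y ∈ cubicZeros c)
    (hxy : y ∉ connectedComponentIn (cubicZeros c) x) :
    ∀ᶠ q : (Fin 10 → ℝ) × RP2 × RP2 in 𝓝 (c, x, y),
      q.2.2 ∉ connectedComponentIn (cubicZeros q.1) q.2.1 := by
  obtain ⟨U, V, hU, hV, hUV, hZ, hxU, hyV⟩ := exists_separation (isClosed_cubicZeros c) hx hy hxy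
  have hcl : IsClosed (Prod.fst '' ({q : (Fin 10 → ℝ) × RP2 | q.2 ∈ cubicZeros q.1} ∩
      {q | q.2 ∈ (U ∪ V)ᶜ})) :=
    isClosedMap_fst_of_compactSpace _ (isClosed_cubicIncidence.inter
      ((hU.union hV).isClosed_compl.preimage continuous_snd))
  have hc : ∀ᶠ c' in 𝓝 c, cubicZeros c' ⊆ U ∪ V := by
    refine Filter.mem_of_superset (hcl.isOpen_compl.mem_nhds ?_) ?_
    · rintro ⟨⟨c', z⟩, ⟨hz, hz'⟩, rfl⟩
      exact hz' (hZ hz)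
    · intro c' hc' z hz
      by_contra hzU
      exact hc' ⟨(c', z), ⟨hz, hzU⟩, rfl⟩
  rw [nhds_prod_eq, nhds_prod_eq]
  have hxU' : ∀ᶠ z in 𝓝 x, z ∈ U := hU.mem_nhds hxU
  have hyV' : ∀ᶠ z in 𝓝 y, z ∈ V := hV.mem_nhds hyV
  filter_upwards [hc.prod_mk (hxU'.prod_mk hyV')] with q hq
  exact notMem_connectedComponentIn_of_separation hU hV hUV hq.1 hq.2.1 hq.2.2

/-- A real plane cubic has at most two connected components. -/
lemma cubicZeros_components {c : Fin 10 → ℝ} {x y z : RP2} (hx : x ∈ cubicZeros c)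
    (hy : y ∈ cubicZeros c) (hz : z ∈ cubicZeros c)
    (hxy : y ∉ connectedComponentIn (cubicZeros c) x)
    (hxz : z ∉ connectedComponentIn (cubicZeros c) x) :
    z ∈ connectedComponentIn (cubicZeros c) y := by
  by_contra hyz
  have hZ := isClosed_cubicZeros c
  obtain ⟨U₁, V₁, hU₁, hV₁, hUV₁, hZ₁, hxU₁, hyV₁⟩ := exists_separation hZ hx hy hxy
  obtain ⟨U₂, V₂, hU₂, hV₂, hUV₂, hZ₂, hxU₂, hzV₂⟩ := exists_separation hZ hx hz hxz
  obtain ⟨U₃, V₃, hU₃, hV₃, hUV₃, hZ₃, hyU₃, hzV₃⟩ := exists_separation hZ hy hz hyz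
  have d₁ : ∀ {w}, w ∈ U₁ → w ∉ V₁ := fun h h' => hUV₁.le_bot ⟨h, h'⟩
  have d₂ : ∀ {w}, w ∈ U₂ → w ∉ V₂ := fun h h' => hUV₂.le_bot ⟨h, h'⟩
  have d₃ : ∀ {w}, w ∈ U₃ → w ∉ V₃ := fun h h' => hUV₃.le_bot ⟨h, h'⟩
  let K : Fin 3 → Set RP2 := ![cubicZeros c ∩ V₁ᶜ ∩ V₂ᶜ, cubicZeros c ∩ (U₁ ∩ U₂)ᶜ ∩ V₃ᶜ,
    cubicZeros c ∩ (U₁ ∩ U₂)ᶜ ∩ U₃ᶜ]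
  have hKcl : ∀ i, IsClosed (K i) := by
    intro i
    fin_cases i
    · exact (hZ.inter hV₁.isClosed_compl).inter hV₂.isClosed_compl
    · exact (hZ.inter (hU₁.inter hU₂).isClosed_compl).inter hV₃.isClosed_compl
    · exact (hZ.inter (hU₁.inter hU₂).isClosed_compl).inter hU₃.isClosed_compl
  have h01 : ∀ w, w ∈ K 0 → w ∉ K 1 := fun w h h' =>
    h'.1.2 ⟨(hZ₁ h.1.1).resolve_right h.1.2, (hZ₂ h.1.1).resolve_right h.2⟩
  have h02 : ∀ w, w ∈ K 0 → w ∉ K 2 := fun w h h' =>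
    h'.1.2 ⟨(hZ₁ h.1.1).resolve_right h.1.2, (hZ₂ h.1.1).resolve_right h.2⟩
  have h12 : ∀ w, w ∈ K 1 → w ∉ K 2 := fun w h h' => (hZ₃ h.1.1).elim h'.2 h.2
  have hdisj : ∀ i j, i ≠ j → ∀ w, w ∈ K i → w ∉ K j := by
    intro i j hij w hi hj
    fin_cases i <;> fin_cases j
    all_goals first
      | exact hij rfl
      | exact h01 w hi hj
      | exact h01 w hj hi
      | exact h02 w hi hj
      | exact h02 w hj hi
      | exact h12 w hi hj
      | exact h12 w hj hi
  have hcov : ∀ w ∈ cubicZeros c, ∃ i, w ∈ K i := by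
    intro w hw
    by_cases h : w ∈ U₁ ∩ U₂
    · exact ⟨0, ⟨hw, d₁ h.1⟩, d₂ h.2⟩
    · rcases hZ₃ hw with h3 | h3
      · exact ⟨1, ⟨hw, h⟩, d₃ h3⟩
      · exact ⟨2, ⟨hw, h⟩, fun h' => d₃ h' h3⟩
  have hne : ∀ i, ∃ w ∈ K i, w ∈ cubicZeros c := by
    intro i
    fin_cases i
    · exact ⟨x, ⟨⟨hx, d₁ hxU₁⟩, d₂ hxU₂⟩, hx⟩
    · exact ⟨y, ⟨⟨hy, fun h => d₁ h.1 hyV₁⟩, d₃ hyU₃⟩, hy⟩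
    · exact ⟨z, ⟨⟨hz, fun h => d₂ h.2 hzV₂⟩, fun h => d₃ h hzV₃⟩, hz⟩
  refine ConeSplitting.false_of_cubicForm (c := c)
    (C := fun i => {v | ∀ hv : v ≠ 0, toRP2 ⟨v, hv⟩ ∈ K i})
    ⟨fun i => ?_, fun i μ v hv hμv => ?_, fun i j v hij hi hj => ?_, fun v hv => ?_⟩ fun i => ?_
  · have hopen : IsOpen (Subtype.val '' (toRP2 ⁻¹' (K i)ᶜ)) :=
      (isOpen_compl_singleton (x := (0 : Fin 3 → ℝ))).isOpenMap_subtype_val _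
        ((hKcl i).isOpen_compl.preimage isOpenQuotientMap_toRP2.continuous)
    convert hopen.isClosed_compl using 1
    ext v
    simp
  · have hμ : μ ≠ 0 := fun h => hμv (by rw [h, zero_smul])
    have hv0 : v ≠ 0 := fun h => hμv (by rw [h, smul_zero])
    rw [toRP2_smul ⟨v, hv0⟩ hμ]
    exact hv hv0
  · by_contra hv
    exact hdisj i j hij _ (hi hv) (hj hv)
  · by_cases hv0 : v = 0
    · exact ⟨0, fun h => absurd hv0 h⟩
    · obtain ⟨i, hi⟩ := hcov (toRP2 ⟨v, hv0⟩) (toRP2_mem_cubicZeros.2 hv)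
      exact ⟨i, fun _ => hi⟩
  · obtain ⟨w, hwK, hwZ⟩ := hne i
    obtain ⟨v, rfl⟩ := isOpenQuotientMap_toRP2.surjective w
    exact ⟨v.1, fun _ => hwK, v.2, toRP2_mem_cubicZeros.1 hwZ⟩

/-! ### The linear system of cubics through eight points -/

/-- Through any nine points passes a cubic. -/
lemma exists_cubic_through_nine (x : Fin 9 → RP2) :
    ∃ c : Fin 10 → ℝ, ‖c‖ = 1 ∧ ∀ i, x i ∈ cubicZeros c := by
  let φ : (Fin 10 → ℝ) →ₗ[ℝ] (Fin 9 → ℝ) :=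
    { toFun := fun c i => cubicForm c (x i).rep
      map_add' := fun c c' => by
        ext i
        rw [Pi.add_apply, cubicForm_add_left]
      map_smul' := fun μ c => by
        ext i
        rw [Pi.smul_apply, cubicForm_smul_left, smul_eq_mul, RingHom.id_apply] }
  obtain ⟨c, hc, hc0⟩ := (Submodule.ne_bot_iff _).1
    (LinearMap.ker_ne_bot_of_finrank_lt (f := φ) (by simp))
  have hmem : ∀ i, x i ∈ cubicZeros c := fun i => congrFun (LinearMap.mem_ker.1 hc) i
  refine ⟨‖c‖⁻¹ • c, by simp [norm_smul, hc0], fun i => ?_⟩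
  rw [cubicZeros_smul (inv_ne_zero (norm_ne_zero_iff.2 hc0))]
  exact hmem i

/-- Pairs of a nonzero cubic through the points `p` and a point on it. -/
def cubicPairs {ι : Type*} (p : ι → RP2) : Set ((Fin 10 → ℝ) × RP2) :=
  {q | q.1 ≠ 0 ∧ (∀ i, p i ∈ cubicZeros q.1) ∧ q.2 ∈ cubicZeros q.1}

/-- The pairs for which the point lies on the component of `p i₀`. -/
def cubicPairsConnected {ι : Type*} (p : ι → RP2) (i₀ : ι) : Set (cubicPairs p) :=
  {q | q.1.2 ∈ connectedComponentIn (cubicZeros q.1.1) (p i₀)}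

lemma isClopen_cubicPairsConnected {ι : Type*} {p : ι → RP2} {i₀ : ι}
    (hp : ∀ c, c ≠ 0 → (∀ i, p i ∈ cubicZeros c) →
      ∃ m, p m ∉ connectedComponentIn (cubicZeros c) (p i₀)) :
    IsClopen (cubicPairsConnected p i₀) := by
  have hopen : ∀ (q : cubicPairs p) (f : cubicPairs p → RP2 × RP2), Continuous f →
      (f q).1 ∈ cubicZeros q.1.1 → (f q).2 ∈ cubicZeros q.1.1 →
      (f q).2 ∉ connectedComponentIn (cubicZeros q.1.1) (f q).1 →
      ∀ᶠ q' in 𝓝 q, (f q').2 ∉ connectedComponentIn (cubicZeros q'.1.1) (f q').1 := by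
    intro q f hf h₁ h₂ h₃
    have hcont : Continuous fun q' : cubicPairs p => (q'.1.1, f q') := by fun_prop
    have h := eventually_notMem_connectedComponentIn h₁ h₂ h₃
    exact (hcont.tendsto q).eventually h
  constructor
  · rw [← isOpen_compl_iff, isOpen_iff_mem_nhds]
    intro q hq
    exact hopen q (fun q' => (p i₀, q'.1.2)) (by fun_prop) (q.2.2.1 i₀) q.2.2.2 hq
  · rw [isOpen_iff_mem_nhds]
    intro q hq
    obtain ⟨m, hm⟩ := hp q.1.1 q.2.1 q.2.2.1
    have hq' : q.1.2 ∈ connectedComponentIn (cubicZeros q.1.1) (p i₀) := hq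
    have hmx : q.1.2 ∉ connectedComponentIn (cubicZeros q.1.1) (p m) := fun h => by
      rw [connectedComponentIn_eq hq', ← connectedComponentIn_eq h] at hm
      exact hm (mem_connectedComponentIn (q.2.2.1 m))
    filter_upwards [
      hopen q (fun q' => (p m, q'.1.2)) (by fun_prop) (q.2.2.1 m) q.2.2.2 hmx,
      hopen q (fun _ => (p i₀, p m)) (by fun_prop) (q.2.2.1 i₀) (q.2.2.1 m) hm] with q' h₁ h₂
    by_contra h₃
    exact h₁ (cubicZeros_components (q'.2.2.1 i₀) (q'.2.2.1 m) q'.2.2.2 h₂ h₃)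

lemma isClosed_snd_image_of_unit {ι : Type*} {p : ι → RP2} {A : Set (cubicPairs p)}
    (hA : IsClosed A) : IsClosed {x : RP2 | ∃ q ∈ A, ‖q.1.1‖ = 1 ∧ q.1.2 = x} := by
  have hN : IsCompact {q : cubicPairs p | ‖q.1.1‖ = 1} := by
    rw [Subtype.isCompact_iff]
    have : Subtype.val '' {q : cubicPairs p | ‖q.1.1‖ = 1} =
        (Metric.sphere (0 : Fin 10 → ℝ) 1 ×ˢ (univ : Set RP2)) ∩
          {q | (∀ i, p i ∈ cubicZeros q.1) ∧ q.2 ∈ cubicZeros q.1} := by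
      ext ⟨c, x⟩
      constructor
      · rintro ⟨⟨_, h0, h1⟩, hn, rfl⟩
        exact ⟨⟨by simpa using hn, mem_univ _⟩, h1⟩
      · rintro ⟨⟨hn, _⟩, h1⟩
        exact ⟨⟨(c, x), ne_zero_of_mem_unit_sphere ⟨c, hn⟩, h1⟩, by simpa using hn, rfl⟩
    rw [this]
    refine ((isCompact_sphere _ _).prod isCompact_univ).inter_right (IsClosed.inter ?_ ?_)
    · change IsClosed {q : (Fin 10 → ℝ) × RP2 | ∀ i, p i ∈ cubicZeros q.1}
      rw [ofPred_forall]
      exact isClosed_iInter fun i => isClosed_cubicIncidence.preimage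
        (by fun_prop : Continuous fun q : (Fin 10 → ℝ) × RP2 => (q.1, p i))
    · exact isClosed_cubicIncidence
  have himage := ((hN.inter_left hA).image
    (by fun_prop : Continuous fun q : cubicPairs p => q.1.2)).isClosed
  convert himage using 1
  ext x
  simp only [mem_ofPred_eq, mem_image, mem_inter_iff, and_assoc]

/-- For a fixed point, the connectedness alternative does not depend on the cubic. -/
lemma cubicPairsConnected_iff_of_isClopen {ι : Type*} {p : ι → RP2} {i₀ : ι}
    (hclopen : IsClopen (cubicPairsConnected p i₀)) {q q' : cubicPairs p} (hqq' : q.1.2 = q'.1.2)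
    (hq : q ∈ cubicPairsConnected p i₀) : q' ∈ cubicPairsConnected p i₀ := by
  obtain ⟨⟨c, x⟩, hc0, hpc, hxc⟩ := q
  obtain ⟨⟨c', x'⟩, hc0', hpc', hxc'⟩ := q'
  obtain rfl : x = x' := hqq'
  by_contra hq'
  by_cases hdep : ∃ t : ℝ, (1 - t) • c + t • c' = 0
  · obtain ⟨t, ht⟩ := hdep
    have ht0 : t ≠ 0 := fun h => hc0 (by simpa [h] using ht)
    have ht1 : 1 - t ≠ 0 := fun h => hc0' (by
      have : t = 1 := by linarith
      simpa [this] using ht)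
    have hcc : cubicZeros c = cubicZeros c' := by
      rw [← cubicZeros_smul (c := c) ht1, eq_neg_of_add_eq_zero_left ht, ← neg_smul,
        cubicZeros_smul (neg_ne_zero.2 ht0)]
    refine hq' ?_
    change x ∈ connectedComponentIn (cubicZeros c') (p i₀)
    rw [← hcc]
    exact hq
  · push Not at hdep
    have hmem : ∀ (t : ℝ) y, y ∈ cubicZeros c → y ∈ cubicZeros c' →
        y ∈ cubicZeros ((1 - t) • c + t • c') := by
      intro t y hy hy'
      change cubicForm _ _ = 0
      rw [cubicForm_add_left, cubicForm_smul_left, cubicForm_smul_left,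
        show cubicForm c y.rep = 0 from hy, show cubicForm c' y.rep = 0 from hy']
      ring
    let γ : ℝ → cubicPairs p := fun t => ⟨((1 - t) • c + t • c', x), hdep t,
      fun i => hmem t _ (hpc i) (hpc' i), hmem t _ hxc hxc'⟩
    have hγ : Continuous γ := by
      refine Continuous.subtype_mk ?_ _
      fun_prop
    refine false_of_path_between_closed hγ hclopen.isClosed hclopen.compl.isClosed
      (fun t _ => em _) (fun t _ h h' => h' h) ?_ ?_
    · convert hq using 1
      exact Subtype.ext (by simp [γ])
    · rw [mem_compl_iff]
      convert hq' using 2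
      exact Subtype.ext (by simp [γ])

/-- Some cubic has a connected component through eight given points. -/
lemma exists_cubicZeros_component (p : Fin 8 → RP2) :
    ∃ c : Fin 10 → ℝ, c ≠ 0 ∧ (∀ i, p i ∈ cubicZeros c) ∧
      ∀ i, p i ∈ connectedComponentIn (cubicZeros c) (p 0) := by
  by_contra! hcon
  have hclopen := isClopen_cubicPairsConnected (i₀ := 0) hcon
  have hex : ∀ x : RP2, ∃ q : cubicPairs p, ‖q.1.1‖ = 1 ∧ q.1.2 = x := by
    intro x
    obtain ⟨c, hc, hmem⟩ := exists_cubic_through_nine (Fin.snoc p x)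
    refine ⟨⟨(c, x), ?_, fun i => ?_, ?_⟩, hc, rfl⟩
    · rintro rfl
      simp at hc
    · simpa using hmem i.castSucc
    · simpa only [Fin.snoc_last] using hmem (Fin.last 8)
  obtain ⟨q, hq1, hq⟩ := hex (p 0)
  obtain ⟨m, hm⟩ := hcon q.1.1 q.2.1 q.2.2.1
  obtain ⟨x, -, ⟨q₁, hq₁, -, hx₁⟩, ⟨q₂, hq₂, -, hx₂⟩⟩ :=
    isPreconnected_closed_iff.1 (isPreconnected_univ (α := RP2)) _ _
    (isClosed_snd_image_of_unit hclopen.isClosed)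
    (isClosed_snd_image_of_unit hclopen.compl.isClosed)
    (fun x _ => by
      obtain ⟨q, hq1, hq⟩ := hex x
      exact (em (q ∈ cubicPairsConnected p 0)).imp (fun h => ⟨q, h, hq1, hq⟩)
        fun h => ⟨q, h, hq1, hq⟩)
    ⟨p 0, mem_univ _, q, by
      change q.1.2 ∈ connectedComponentIn (cubicZeros q.1.1) (p 0)
      rw [hq]
      exact mem_connectedComponentIn (q.2.2.1 0), hq1, hq⟩
    ⟨p m, mem_univ _, ⟨(q.1.1, p m), q.2.1, q.2.2.1, q.2.2.1 m⟩, hm, hq1, rfl⟩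
  exact hq₂ (cubicPairsConnected_iff_of_isClopen hclopen (hx₁.trans hx₂.symm) hq₁)

/-! ### Passage to polynomials -/

open MvPolynomial in
/-- The polynomial with coefficient vector `c`. -/
def cubicPolynomial (c : Fin 10 → ℝ) : MvPolynomial (Fin 3) ℝ :=
  C (c 0) * (X 0 * X 0 * X 0) + C (c 1) * (X 0 * X 0 * X 1) + C (c 2) * (X 0 * X 0 * X 2)
    + C (c 3) * (X 0 * X 1 * X 1) + C (c 4) * (X 0 * X 1 * X 2) + C (c 5) * (X 0 * X 2 * X 2)
    + C (c 6) * (X 1 * X 1 * X 1) + C (c 7) * (X 1 * X 1 * X 2) + C (c 8) * (X 1 * X 2 * X 2)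
    + C (c 9) * (X 2 * X 2 * X 2)

lemma eval_cubicPolynomial (c : Fin 10 → ℝ) (v : Fin 3 → ℝ) :
    MvPolynomial.eval v (cubicPolynomial c) = cubicForm c v := by
  simp [cubicPolynomial, cubicForm]
  ring

lemma isHomogeneous_cubicPolynomial (c : Fin 10 → ℝ) : (cubicPolynomial c).IsHomogeneous 3 := by
  have h : ∀ (a : ℝ) (i j k : Fin 3), (MvPolynomial.C a * (MvPolynomial.X i * MvPolynomial.X j *
      MvPolynomial.X k) : MvPolynomial (Fin 3) ℝ).IsHomogeneous 3 := fun a i j k =>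
    (((MvPolynomial.isHomogeneous_X ℝ i).mul (MvPolynomial.isHomogeneous_X ℝ j)).mul
      (MvPolynomial.isHomogeneous_X ℝ k)).C_mul a
  unfold cubicPolynomial
  repeat' apply MvPolynomial.IsHomogeneous.add
  all_goals exact h _ _ _ _

lemma cubicPolynomial_ne_zero {c : Fin 10 → ℝ} (hc : c ≠ 0) : cubicPolynomial c ≠ 0 := by
  intro h0
  have h : ∀ x y z : ℝ, cubicForm c ![x, y, z] = 0 := fun x y z => by
    rw [← eval_cubicPolynomial, h0, map_zero]
  simp only [cubicForm, Matrix.cons_val_zero, Matrix.cons_val_one, Matrix.cons_val] at h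
  have h1 := h 1 0 0
  have h2 := h 0 1 0
  have h3 := h 0 0 1
  have h4 := h 1 1 0
  have h5 := h 1 (-1) 0
  have h6 := h 1 0 1
  have h7 := h 1 0 (-1)
  have h8 := h 0 1 1
  have h9 := h 0 1 (-1)
  have h10 := h 1 1 1
  refine hc (funext fun i => ?_)
  fin_cases i <;> simp only [Pi.zero_apply, Fin.reduceFinMk, Fin.zero_eta, Fin.mk_one] <;> linarith

/-- Through any 8 points of `ℝP²` one can trace a connected component of the real point set
of a real curve of degree 3 (i.e. `c'(3) ≥ 8`). -/
theorem stmt_5 (p : Fin 8 → RP2) :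
    ∃ F : MvPolynomial (Fin 3) ℝ, F ≠ 0 ∧ F.IsHomogeneous 3 ∧
      inOneComponent (zeroSet F) (Set.range p) := by
  obtain ⟨c, hc, hmem, hcomp⟩ := exists_cubicZeros_component p
  have hZ : zeroSet (cubicPolynomial c) = cubicZeros c := by
    ext x
    simp only [zeroSet, cubicZeros, mem_ofPred_eq, eval_cubicPolynomial]
  refine ⟨cubicPolynomial c, cubicPolynomial_ne_zero hc, isHomogeneous_cubicPolynomial c,
    p 0, hZ ▸ hmem 0, ?_⟩
  rw [hZ]
  exact range_subset_iff.2 hcomp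
end
end

section
/- There exist 9 points in ℝP² such that for every nonzero homogeneous polynomial F ∈ ℝ[x₀,x₁,x₂] of degree 3, no connected component of the real point set Z(F) contains all nine points (i.e. c'(3) ≤ 8, hence c'(3) = 8). -/
noncomputable section

open MvPolynomial in
/-- A ternary cubic form, evaluated at a point, as the sum over its ten monomials. -/
lemma exists_eval_eq_of_isHomogeneous_three {F : MvPolynomial (Fin 3) ℝ}
    (hF : F.IsHomogeneous 3) :
    ∃ c : (Fin 3 → ℕ) → ℝ, ∀ v : Fin 3 → ℝ, eval v F =
      ∑ d ∈ Finset.Nat.antidiagonalTuple 3 3, c d * (v 0 ^ d 0 * v 1 ^ d 1 * v 2 ^ d 2) := by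
  refine ⟨fun d => coeff (Finsupp.equivFunOnFinite.symm d) F, fun v => ?_⟩
  have hinj : Function.Injective (fun d : Fin 3 →₀ ℕ => (d : Fin 3 → ℕ)) := DFunLike.coe_injective
  rw [eval_eq', ← Finset.sum_subset (s₁ := F.support.map ⟨_, hinj⟩)]
  · simp [Finset.sum_map, Fin.prod_univ_three]
  · intro d hd
    obtain ⟨e, he, rfl⟩ := Finset.mem_map.mp hd
    have h := hF (mem_support_iff.mp he)
    rw [Finset.Nat.mem_antidiagonalTuple]
    simpa [Finsupp.weight_apply, Finsupp.sum_fintype] using h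
  · intro d _ hd
    have : coeff (Finsupp.equivFunOnFinite.symm d) F = 0 := by
      by_contra h
      exact hd (Finset.mem_map.mpr ⟨_, mem_support_iff.mpr h, by simp⟩)
    simp [this]

/-- Seven points of the unit circle and two points of the line at infinity. -/
def circleLinePoints : Fin 9 → Fin 3 → ℝ :=
  ![![1, 0, 1], ![-1, 0, 1], ![0, 1, 1], ![0, -1, 1], ![3, 4, 5], ![4, 3, 5], ![-3, 4, 5],
    ![1, 0, 0], ![0, 1, 0]]

lemma circleLinePoints_ne_zero (i : Fin 9) : circleLinePoints i ≠ 0 := by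
  intro h
  have h0 := congrFun h 0
  have h1 := congrFun h 1
  fin_cases i <;> simp [circleLinePoints] at h0 h1

open MvPolynomial in
/-- A cubic through the nine points is a multiple of the product of the circle and the line. -/
lemma exists_eval_eq_mul_circle_line {F : MvPolynomial (Fin 3) ℝ} (hF : F.IsHomogeneous 3)
    (h : ∀ i, eval (circleLinePoints i) F = 0) :
    ∃ c : ℝ, ∀ v : Fin 3 → ℝ, eval v F = c * (v 2 * (v 0 ^ 2 + v 1 ^ 2 - v 2 ^ 2)) := by
  obtain ⟨c, hc⟩ := exists_eval_eq_of_isHomogeneous_three hF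
  have hS : Finset.Nat.antidiagonalTuple 3 3 = {![0, 0, 3], ![0, 1, 2], ![0, 2, 1], ![0, 3, 0],
      ![1, 0, 2], ![1, 1, 1], ![1, 2, 0], ![2, 0, 1], ![2, 1, 0], ![3, 0, 0]} := by decide
  have hc' : ∀ v : Fin 3 → ℝ, eval v F = c ![0, 0, 3] * v 2 ^ 3 + c ![0, 1, 2] * (v 1 * v 2 ^ 2)
      + c ![0, 2, 1] * (v 1 ^ 2 * v 2) + c ![0, 3, 0] * v 1 ^ 3 + c ![1, 0, 2] * (v 0 * v 2 ^ 2)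
      + c ![1, 1, 1] * (v 0 * v 1 * v 2) + c ![1, 2, 0] * (v 0 * v 1 ^ 2)
      + c ![2, 0, 1] * (v 0 ^ 2 * v 2) + c ![2, 1, 0] * (v 0 ^ 2 * v 1)
      + c ![3, 0, 0] * v 0 ^ 3 := by
    intro v
    rw [hc, hS]
    repeat rw [Finset.sum_insert (by decide)]
    rw [Finset.sum_singleton]
    simp
    ring
  generalize c ![0, 0, 3] = a₀ at hc'
  generalize c ![0, 1, 2] = a₁ at hc'
  generalize c ![0, 2, 1] = a₂ at hc'
  generalize c ![0, 3, 0] = a₃ at hc'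
  generalize c ![1, 0, 2] = a₄ at hc'
  generalize c ![1, 1, 1] = a₅ at hc'
  generalize c ![1, 2, 0] = a₆ at hc'
  generalize c ![2, 0, 1] = a₇ at hc'
  generalize c ![2, 1, 0] = a₈ at hc'
  generalize c ![3, 0, 0] = a₉ at hc'
  have h0 := h 0
  have h1 := h 1
  have h2 := h 2
  have h3 := h 3
  have h4 := h 4
  have h5 := h 5
  have h6 := h 6
  have h7 := h 7
  have h8 := h 8
  simp [hc', circleLinePoints] at h0 h1 h2 h3 h4 h5 h6 h7 h8
  refine ⟨a₂, fun v => ?_⟩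
  have e₀ : a₀ = -a₂ := by linarith
  have e₇ : a₇ = a₂ := by linarith
  have e₁ : a₁ = 0 := by linarith
  have e₄ : a₄ = 0 := by linarith
  have e₅ : a₅ = 0 := by linarith
  have e₆ : a₆ = 0 := by linarith
  have e₈ : a₈ = 0 := by linarith
  rw [hc', e₀, e₇, e₁, e₄, e₅, e₆, e₈, h7, h8]
  ring

open MvPolynomial in
lemma eval_smul_of_isHomogeneous {F : MvPolynomial (Fin 3) ℝ} {n : ℕ} (hF : F.IsHomogeneous n)
    (a : ℝ) (v : Fin 3 → ℝ) : eval (a • v) F = a ^ n * eval v F := by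
  rw [eval_eq', eval_eq', Finset.mul_sum]
  refine Finset.sum_congr rfl fun d hd => ?_
  have h : ∑ i, d i = n := by
    simpa [Finsupp.weight_apply, Finsupp.sum_fintype] using hF (mem_support_iff.mp hd)
  simp only [Pi.smul_apply, smul_eq_mul, mul_pow, Finset.prod_mul_distrib,
    Finset.prod_pow_eq_pow_sum, h]
  ring

lemma mk_mem_zeroSet_iff {F : MvPolynomial (Fin 3) ℝ} {n : ℕ} (hF : F.IsHomogeneous n)
    {v : Fin 3 → ℝ} (hv : v ≠ 0) :
    Projectivization.mk ℝ v hv ∈ zeroSet F ↔ MvPolynomial.eval v F = 0 := by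
  obtain ⟨a, ha⟩ := Projectivization.exists_smul_eq_mk_rep ℝ v hv
  rw [zeroSet, Set.mem_ofPred_eq, ← ha, Units.smul_def, eval_smul_of_isHomogeneous hF]
  simp

lemma isClosed_zeroSet {F : MvPolynomial (Fin 3) ℝ} {n : ℕ} (hF : F.IsHomogeneous n) :
    IsClosed (zeroSet F) := by
  have hq : Topology.IsQuotientMap
      (fun v : {v : Fin 3 → ℝ // v ≠ 0} => Projectivization.mk ℝ v.1 v.2) :=
    isQuotientMap_quotient_mk'
  rw [← hq.isClosed_preimage]
  have : (fun v : {v : Fin 3 → ℝ // v ≠ 0} => Projectivization.mk ℝ v.1 v.2) ⁻¹' zeroSet F =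
      {v | MvPolynomial.eval v.1 F = 0} := by
    ext v
    exact mk_mem_zeroSet_iff hF v.2
  rw [this]
  exact isClosed_eq ((MvPolynomial.continuous_eval F).comp continuous_subtype_val)
    continuous_const

/-- There exist 9 points of `ℝP²` such that no connected component of the real point set of
a real curve of degree 3 contains all of them (i.e. `c'(3) ≤ 8`). -/
theorem stmt_6 :
    ∃ p : Fin 9 → RP2, ∀ F : MvPolynomial (Fin 3) ℝ, F ≠ 0 → F.IsHomogeneous 3 →
      ¬ inOneComponent (zeroSet F) (Set.range p) := by
  refine ⟨fun i => Projectivization.mk ℝ _ (circleLinePoints_ne_zero i), ?_⟩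
  rintro F hF0 hF ⟨p, hp, hsub⟩
  have hmem i := hsub (Set.mem_range_self i)
  have hZ := connectedComponentIn_subset (zeroSet F) p
  obtain ⟨c, hc⟩ := exists_eval_eq_mul_circle_line hF fun i =>
    (mk_mem_zeroSet_iff hF (circleLinePoints_ne_zero i)).mp (hZ (hmem i))
  have hc0 : c ≠ 0 := by
    rintro rfl
    exact hF0 (MvPolynomial.funext fun v => by simp [hc])
  let L : MvPolynomial (Fin 3) ℝ := MvPolynomial.X 2
  let C : MvPolynomial (Fin 3) ℝ :=
    MvPolynomial.X 0 ^ 2 + MvPolynomial.X 1 ^ 2 - MvPolynomial.X 2 ^ 2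
  have hL : L.IsHomogeneous 1 := MvPolynomial.isHomogeneous_X ℝ 2
  have hC : C.IsHomogeneous 2 :=
    ((MvPolynomial.isHomogeneous_X_pow 0 2).add (MvPolynomial.isHomogeneous_X_pow 1 2)).sub
      (MvPolynomial.isHomogeneous_X_pow 2 2)
  obtain ⟨q, -, hqL, hqC⟩ := isPreconnected_closed_iff.mp
    (isPreconnected_connectedComponentIn (F := zeroSet F) (x := p))
    (zeroSet L) (zeroSet C) (isClosed_zeroSet hL) (isClosed_zeroSet hC)
    (fun q hq => by
      have h : MvPolynomial.eval q.rep F = 0 := hZ hq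
      rw [hc] at h
      simpa [hc0, zeroSet, L, C] using h)
    ⟨_, hmem 7, (mk_mem_zeroSet_iff hL (circleLinePoints_ne_zero 7)).mpr (by
      simp [L, circleLinePoints])⟩
    ⟨_, hmem 0, (mk_mem_zeroSet_iff hC (circleLinePoints_ne_zero 0)).mpr (by
      simp [C, circleLinePoints])⟩
  have h2 : q.rep 2 = 0 := by simpa [zeroSet, L] using hqL
  have hsq : q.rep 0 ^ 2 + q.rep 1 ^ 2 = 0 := by simpa [zeroSet, C, h2] using hqC
  have h0 : q.rep 0 = 0 := by nlinarith [sq_nonneg (q.rep 0), sq_nonneg (q.rep 1)]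
  have h1 : q.rep 1 = 0 := by nlinarith [sq_nonneg (q.rep 0), sq_nonneg (q.rep 1)]
  apply q.rep_nonzero
  ext i
  fin_cases i <;> simp [h0, h1, h2]
end
end

section
/- There exist 14 points in ℝP² such that for every nonzero homogeneous polynomial F ∈ ℝ[x₀,x₁,x₂] of degree 4, no connected component of the real point set Z(F) contains all fourteen points (i.e. c'(4) ≤ 13, hence c'(4) = 13). -/
noncomputable section

/-- A ternary quartic form, evaluated pointwise, is a combination of the fifteen monomials. -/
theorem eval_quartic {F : MvPolynomial (Fin 3) ℝ} (hF : F.IsHomogeneous 4) :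
    ∃ c : (Fin 3 → ℕ) → ℝ, ∀ x : Fin 3 → ℝ, MvPolynomial.eval x F =
      ∑ t ∈ Finset.Nat.antidiagonalTuple 3 4, c t * (x 0 ^ t 0 * x 1 ^ t 1 * x 2 ^ t 2) := by
  refine ⟨fun t => F.coeff (Finsupp.equivFunOnFinite.symm t), fun x => ?_⟩
  have hsub : F.support ⊆ (Finset.Nat.antidiagonalTuple 3 4).map
      Finsupp.equivFunOnFinite.symm.toEmbedding := by
    intro d hd
    rw [Finset.mem_map]
    refine ⟨d, ?_, by ext; simp⟩
    rw [Finset.Nat.mem_antidiagonalTuple, ← Finsupp.degree_eq_sum, Finsupp.degree_eq_weight_one]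
    exact hF (MvPolynomial.mem_support_iff.mp hd)
  rw [MvPolynomial.eval_eq', Finset.sum_subset hsub, Finset.sum_map]
  · simp [Fin.prod_univ_three]
  · intro d _ hd
    simp [MvPolynomial.notMem_support_iff.mp hd]

/-- Vanishing of a homogeneous polynomial at a point of `ℝP²` can be tested on any
representative. -/
theorem eval_eq_zero_of_mk_mem_zeroSet {F : MvPolynomial (Fin 3) ℝ} (hF : F.IsHomogeneous 4)
    {v : Fin 3 → ℝ} (hv : v ≠ 0) (h : Projectivization.mk ℝ v hv ∈ zeroSet F) :
    MvPolynomial.eval v F = 0 := by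
  obtain ⟨a, ha⟩ := Projectivization.exists_smul_eq_mk_rep ℝ v hv
  obtain ⟨c, hc⟩ := eval_quartic hF
  have key : MvPolynomial.eval ((a : ℝ) • v) F = (a : ℝ) ^ 4 * MvPolynomial.eval v F := by
    rw [hc, hc, Finset.mul_sum]
    refine Finset.sum_congr rfl fun t ht => ?_
    rw [Finset.Nat.mem_antidiagonalTuple, Fin.sum_univ_three] at ht
    simp only [Pi.smul_apply, smul_eq_mul, ← ht, mul_pow, pow_add]
    ring
  have h0 : MvPolynomial.eval (Projectivization.mk ℝ v hv).rep F = 0 := h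
  rw [← ha, Units.smul_def, key] at h0
  simpa using h0

/-- The sign of the quadratic form `x₀² + x₁² - 2x₂²` does not depend on the representative. -/
theorem exists_pos_mul_eq_rep {v : Fin 3 → ℝ} (hv : v ≠ 0) :
    ∃ b : ℝ, 0 < b ∧ (Projectivization.mk ℝ v hv).rep 0 ^ 2 + (Projectivization.mk ℝ v hv).rep 1 ^ 2
      - 2 * (Projectivization.mk ℝ v hv).rep 2 ^ 2 = b * (v 0 ^ 2 + v 1 ^ 2 - 2 * v 2 ^ 2) := by
  obtain ⟨a, ha⟩ := Projectivization.exists_smul_eq_mk_rep ℝ v hv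
  refine ⟨(a : ℝ) ^ 2, by have := a.ne_zero; positivity, ?_⟩
  rw [← ha, Units.smul_def]
  simp only [Pi.smul_apply, smul_eq_mul]
  ring

/-- The points of `ℝP²` strictly inside the circle `x₀² + x₁² = 2x₂²`. -/
def insideCircle : Set RP2 := {p | p.rep 0 ^ 2 + p.rep 1 ^ 2 - 2 * p.rep 2 ^ 2 < 0}

/-- The points of `ℝP²` strictly outside the circle `x₀² + x₁² = 2x₂²`. -/
def outsideCircle : Set RP2 := {p | 0 < p.rep 0 ^ 2 + p.rep 1 ^ 2 - 2 * p.rep 2 ^ 2}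

theorem mk_mem_insideCircle {v : Fin 3 → ℝ} (hv : v ≠ 0) :
    Projectivization.mk ℝ v hv ∈ insideCircle ↔ v 0 ^ 2 + v 1 ^ 2 - 2 * v 2 ^ 2 < 0 := by
  obtain ⟨b, hb, h⟩ := exists_pos_mul_eq_rep hv
  rw [insideCircle, Set.mem_ofPred_eq, h, mul_neg_iff]
  constructor
  · rintro (⟨_, h⟩ | ⟨h, _⟩)
    · exact h
    · exact absurd h hb.not_gt
  · exact fun h => Or.inl ⟨hb, h⟩

theorem mk_mem_outsideCircle {v : Fin 3 → ℝ} (hv : v ≠ 0) :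
    Projectivization.mk ℝ v hv ∈ outsideCircle ↔ 0 < v 0 ^ 2 + v 1 ^ 2 - 2 * v 2 ^ 2 := by
  obtain ⟨b, hb, h⟩ := exists_pos_mul_eq_rep hv
  rw [outsideCircle, Set.mem_ofPred_eq, h, mul_pos_iff_of_pos_left hb]

theorem continuous_circleForm :
    Continuous fun v : Fin 3 → ℝ => v 0 ^ 2 + v 1 ^ 2 - 2 * v 2 ^ 2 := by
  fun_prop

theorem isOpen_insideCircle : IsOpen insideCircle := by
  refine isOpen_coinduced.mpr ?_
  have : IsOpen {v : {v : Fin 3 → ℝ // v ≠ 0} |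
      v.1 0 ^ 2 + v.1 1 ^ 2 - 2 * v.1 2 ^ 2 < 0} :=
    isOpen_lt (continuous_circleForm.comp continuous_subtype_val) continuous_const
  convert this using 1
  ext v
  exact mk_mem_insideCircle v.2

theorem isOpen_outsideCircle : IsOpen outsideCircle := by
  refine isOpen_coinduced.mpr ?_
  have : IsOpen {v : {v : Fin 3 → ℝ // v ≠ 0} |
      0 < v.1 0 ^ 2 + v.1 1 ^ 2 - 2 * v.1 2 ^ 2} :=
    isOpen_lt continuous_const (continuous_circleForm.comp continuous_subtype_val)
  convert this using 1
  ext v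
  exact mk_mem_outsideCircle v.2

/-- Nine points on the circle `x₀² + x₁² = x₂²` followed by five points on
`x₀² + x₁² = 4x₂²`. -/
def circlePoint : Fin 14 → Fin 3 → ℝ :=
  ![![1, 0, 1], ![-1, 0, 1], ![0, 1, 1], ![0, -1, 1], ![3, 4, 5], ![-3, 4, 5], ![3, -4, 5],
    ![-3, -4, 5], ![4, 3, 5], ![2, 0, 1], ![-2, 0, 1], ![0, 2, 1], ![0, -2, 1], ![6, 8, 5]]

theorem circlePoint_ne_zero (i : Fin 14) : circlePoint i ≠ 0 := by
  intro h
  have h2 := congrFun h 2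
  fin_cases i <;> simp [circlePoint] at h2

/-- Up to a scalar, the product of the two circles is the only quartic through the fourteen
points. -/
theorem exists_eval_eq_mul_circles {F : MvPolynomial (Fin 3) ℝ} (hF : F.IsHomogeneous 4)
    (h : ∀ i, MvPolynomial.eval (circlePoint i) F = 0) :
    ∃ k : ℝ, ∀ x : Fin 3 → ℝ, MvPolynomial.eval x F =
      k * ((x 0 ^ 2 + x 1 ^ 2 - x 2 ^ 2) * (x 0 ^ 2 + x 1 ^ 2 - 4 * x 2 ^ 2)) := by
  obtain ⟨c, hc⟩ := eval_quartic hF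
  have monomials : Finset.Nat.antidiagonalTuple 3 4 =
      {![0, 0, 4], ![0, 1, 3], ![0, 2, 2], ![0, 3, 1], ![0, 4, 0], ![1, 0, 3], ![1, 1, 2],
        ![1, 2, 1], ![1, 3, 0], ![2, 0, 2], ![2, 1, 1], ![2, 2, 0], ![3, 0, 1], ![3, 1, 0],
        ![4, 0, 0]} := by decide
  rw [monomials] at hc
  simp only [hc] at h ⊢
  simp [circlePoint, Fin.forall_fin_succ] at h
  obtain ⟨e0, e1, e2, e3, e4, e5, e6, e7, e8, e9, e10, e11, e12, e13⟩ := h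
  have h004 : c ![0, 0, 4] = 4 * c ![4, 0, 0] := by linarith
  have h013 : c ![0, 1, 3] = 0 := by linarith
  have h022 : c ![0, 2, 2] = -5 * c ![4, 0, 0] := by linarith
  have h031 : c ![0, 3, 1] = 0 := by linarith
  have h040 : c ![0, 4, 0] = c ![4, 0, 0] := by linarith
  have h103 : c ![1, 0, 3] = 0 := by linarith
  have h112 : c ![1, 1, 2] = 0 := by linarith
  have h121 : c ![1, 2, 1] = 0 := by linarith
  have h130 : c ![1, 3, 0] = 0 := by linarith
  have h202 : c ![2, 0, 2] = -5 * c ![4, 0, 0] := by linarith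
  have h211 : c ![2, 1, 1] = 0 := by linarith
  have h220 : c ![2, 2, 0] = 2 * c ![4, 0, 0] := by linarith
  have h301 : c ![3, 0, 1] = 0 := by linarith
  have h310 : c ![3, 1, 0] = 0 := by linarith
  refine ⟨c ![4, 0, 0], fun x => ?_⟩
  simp [h004, h013, h022, h031, h040, h103,
    h112, h121, h130, h202, h211, h220, h301, h310]
  ring

/-- There exist 14 points of `ℝP²` such that no connected component of the real point set of
a real curve of degree 4 contains all of them (i.e. `c'(4) ≤ 13`). -/
theorem stmt_8 :
    ∃ p : Fin 14 → RP2, ∀ F : MvPolynomial (Fin 3) ℝ, F ≠ 0 → F.IsHomogeneous 4 →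
      ¬ inOneComponent (zeroSet F) (Set.range p) := by
  refine ⟨fun i => Projectivization.mk ℝ (circlePoint i) (circlePoint_ne_zero i), ?_⟩
  rintro F hF0 hF ⟨p, hp, hS⟩
  obtain ⟨k, hk⟩ := exists_eval_eq_mul_circles hF fun i =>
    eval_eq_zero_of_mk_mem_zeroSet hF (circlePoint_ne_zero i)
      (connectedComponentIn_subset _ _ (hS ⟨i, rfl⟩))
  have hk0 : k ≠ 0 := by
    rintro rfl
    exact hF0 (MvPolynomial.funext fun x => by simp [hk x])
  have hcover : connectedComponentIn (zeroSet F) p ⊆ insideCircle ∪ outsideCircle := by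
    intro q hq
    have hz : MvPolynomial.eval q.rep F = 0 :=
      (connectedComponentIn_subset (zeroSet F) p hq : q ∈ zeroSet F)
    rw [hk, mul_eq_zero, or_iff_right hk0] at hz
    have hne : q.rep 0 ^ 2 + q.rep 1 ^ 2 - 2 * q.rep 2 ^ 2 ≠ 0 := by
      intro h0
      have hsum : q.rep 0 ^ 2 + q.rep 1 ^ 2 = 2 * q.rep 2 ^ 2 := by linarith
      have h2 : q.rep 2 = 0 := by
        rw [hsum] at hz
        have : (q.rep 2) ^ 4 = 0 := by linarith
        simpa using this
      rw [h2] at hsum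
      have h0' : q.rep 0 = 0 := (pow_eq_zero_iff two_ne_zero).mp
        (by nlinarith [sq_nonneg (q.rep 0), sq_nonneg (q.rep 1)])
      have h1 : q.rep 1 = 0 := (pow_eq_zero_iff two_ne_zero).mp
        (by nlinarith [sq_nonneg (q.rep 0), sq_nonneg (q.rep 1)])
      refine q.rep_nonzero (funext fun i => ?_)
      fin_cases i
      exacts [h0', h1, h2]
    exact lt_or_gt_of_ne hne
  have hdisj : Disjoint insideCircle outsideCircle :=
    Set.disjoint_left.mpr fun _ hi ho =>
      lt_asymm (Set.mem_ofPred.mp hi) (Set.mem_ofPred.mp ho)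
  have hsub := isPreconnected_connectedComponentIn.subset_left_of_subset_union
    isOpen_insideCircle isOpen_outsideCircle hdisj hcover
    ⟨_, hS ⟨0, rfl⟩, (mk_mem_insideCircle _).mpr (by simp [circlePoint])⟩
  have h9 := (mk_mem_insideCircle _).mp (hsub (hS ⟨9, rfl⟩))
  rw [show circlePoint 9 = ![2, 0, 1] from rfl] at h9
  simp at h9
  norm_num at h9
end
end
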